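/- Let S ⊂ (0,∞) be a finite set with |S| ≤ 4 satisfying the 4-values condition and such that S is not ∼-equivalent to {1,2,3,4}. Then every countable ultrahomogeneous metric space U_S with all distances in S ∪ {0} into which every countable metric space with nonzero distances in S embeds isometrically is indivisible. -/

import Mathlib

open Metric

/-- A metric space is ultrahomogeneous if every isometry between two finite
subspaces extends to a surjective self-isometry of the whole space. -/
def IsUltrahomogeneous (X : Type*) [MetricSpace X] : Prop :=
  ∀ F : Set X, F.Finite → ∀ φ : F → X, Isometry φ →
    ∃ ψ : X ≃ᵢ X, ∀ x : F, ψ x = φ x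

/-- A metric space `X` is `ε`-indivisible if for every finite coloring there
is a color `i` and a subset `Y ⊆ X` isometric to `X` with every point of `Y`
within distance `ε` of the `i`-th color class. -/
def EpsIndivisible (X : Type*) [MetricSpace X] (ε : ℝ) : Prop :=
  ∀ k : ℕ, 0 < k → ∀ χ : X → Fin k, ∃ i : Fin k, ∃ e : X → X, Isometry e ∧
    ∀ z : X, ∃ x : X, χ x = i ∧ dist (e z) x ≤ ε

/-- Approximate indivisibility (oscillation stability): `ε`-indivisible for
every `ε > 0`. -/
def ApproxIndivisible (X : Type*) [MetricSpace X] : Prop :=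
  ∀ ε : ℝ, 0 < ε → EpsIndivisible X ε

/-- Exact indivisibility: some color class contains an isometric copy of `X`. -/
def Indivisible (X : Type*) [MetricSpace X] : Prop :=
  ∀ k : ℕ, 0 < k → ∀ χ : X → Fin k, ∃ i : Fin k, ∃ e : X → X, Isometry e ∧
    ∀ z : X, χ (e z) = i

/-- The Urysohn sphere: complete, separable, ultrahomogeneous, of diameter at
most `1`, and universal for separable metric spaces of diameter at most `1`. -/
def IsUrysohnSphere (S : Type) [MetricSpace S] : Prop :=
  CompleteSpace S ∧ TopologicalSpace.SeparableSpace S ∧ IsUltrahomogeneous S ∧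
  (∀ x y : S, dist x y ≤ 1) ∧
  ∀ (Y : Type) [MetricSpace Y], TopologicalSpace.SeparableSpace Y →
    (∀ a b : Y, dist a b ≤ 1) → ∃ f : Y → S, Isometry f

/-- The rational Urysohn sphere: countable, ultrahomogeneous, with distances in
`ℚ ∩ [0,1]`, universal for countable metric spaces with distances in `ℚ ∩ [0,1]`. -/
def IsRationalUrysohnSphere (S : Type) [MetricSpace S] : Prop :=
  Countable S ∧ IsUltrahomogeneous S ∧
  (∀ x y : S, ∃ q : ℚ, 0 ≤ q ∧ q ≤ 1 ∧ dist x y = q) ∧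
  ∀ (Y : Type) [MetricSpace Y], Countable Y →
    (∀ a b : Y, ∃ q : ℚ, 0 ≤ q ∧ q ≤ 1 ∧ dist a b = q) →
    ∃ f : Y → S, Isometry f

/-- `[0,1]_m = {k/m : 0 ≤ k ≤ m}`. -/
def distSetM (m : ℕ) : Set ℝ := {d | ∃ k : ℕ, k ≤ m ∧ d = (k : ℝ) / m}

/-- The space `S_m`: countable, ultrahomogeneous, with distances in `[0,1]_m`,
universal for countable metric spaces with distances in `[0,1]_m`. -/
def IsUrysohnSphereM (m : ℕ) (S : Type) [MetricSpace S] : Prop :=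
  Countable S ∧ IsUltrahomogeneous S ∧
  (∀ x y : S, dist x y ∈ distSetM m) ∧
  ∀ (Y : Type) [MetricSpace Y], Countable Y →
    (∀ a b : Y, dist a b ∈ distSetM m) → ∃ f : Y → S, Isometry f

/-- The 4-values condition of Delhommé–Laflamme–Pouzet–Sauer. -/
def FourValues (S : Set ℝ) : Prop :=
  ∀ s₀ ∈ S, ∀ s₁ ∈ S, ∀ s₀' ∈ S, ∀ s₁' ∈ S,
    (∃ t ∈ S, |s₀ - s₁| ≤ t ∧ t ≤ s₀ + s₁ ∧ |s₀' - s₁'| ≤ t ∧ t ≤ s₀' + s₁') →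
    ∃ u ∈ S, |s₀ - s₀'| ≤ u ∧ u ≤ s₀ + s₀' ∧ |s₁ - s₁'| ≤ u ∧ u ≤ s₁ + s₁'

/-- `S ∼ T`: the order isomorphism between `S` and `T` preserves the relation
`s_i ≤ s_j + s_k`. -/
def SimDist (S T : Set ℝ) : Prop :=
  ∃ e : S ≃o T, ∀ i j k : S, ((i : ℝ) ≤ (j : ℝ) + (k : ℝ)) ↔
    ((e i : ℝ) ≤ (e j : ℝ) + (e k : ℝ))


section UrysohnIndivisible

open Classical

variable {U : Type*} [MetricSpace U] {S : Set ℝ}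

/-- The restriction of `f` to `W` is a Katětov function with values in `S`. -/
def IsKatetov (S : Set ℝ) (W : Set U) (f : U → ℝ) : Prop :=
  (∀ x ∈ W, f x ∈ S) ∧ ∀ x ∈ W, ∀ y ∈ W, f x ≤ dist x y + f y ∧ dist x y ≤ f x + f y

/-- The point `y` has distance `f x` to every `x ∈ F`. -/
def Realizes (F : Finset U) (f : U → ℝ) (y : U) : Prop := ∀ x ∈ F, dist y x = f x

/-- Every Katětov function with values in `S` on a finite subset of `C` is realized in `C`. -/
def HasExtension (S : Set ℝ) (C : Set U) : Prop :=
  ∀ F : Finset U, (F : Set U) ⊆ C → ∀ f, IsKatetov S (F : Set U) f → ∃ y ∈ C, Realizes F f y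

/-- `U` is the Urysohn space of the finite distance set `S`. -/
structure IsUrysohn (S : Set ℝ) (U : Type*) [MetricSpace U] : Prop where
  finite : S.Finite
  nonempty : S.Nonempty
  pos : ∀ s ∈ S, 0 < s
  fourValues : FourValues S
  countable : Countable U
  dist_mem : ∀ x y : U, x ≠ y → dist x y ∈ S
  hasExtension : HasExtension S (Set.univ : Set U)

theorem IsKatetov.mono {W W' : Set U} {f : U → ℝ} (hf : IsKatetov S W f) (h : W' ⊆ W) :
    IsKatetov S W' f :=
  ⟨fun x hx => hf.1 x (h hx), fun x hx y hy => hf.2 x (h hx) y (h hy)⟩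

theorem IsKatetov.congr {W : Set U} {f g : U → ℝ} (hf : IsKatetov S W f)
    (h : ∀ x ∈ W, g x = f x) : IsKatetov S W g :=
  ⟨fun x hx => by rw [h x hx]; exact hf.1 x hx,
    fun x hx y hy => by rw [h x hx, h y hy]; exact hf.2 x hx y hy⟩

/-- Adding a point `x ∉ W` to the domain of a Katětov function. -/
theorem IsKatetov.adjoin {W : Set U} {f : U → ℝ} {x : U} (hf : IsKatetov S W f)
    (hx : f x ∈ S) (hpos : 0 < f x)
    (h : ∀ z ∈ W, f x ≤ dist x z + f z ∧ f z ≤ dist x z + f x ∧ dist x z ≤ f x + f z) :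
    IsKatetov S (insert x W) f := by
  refine ⟨?_, ?_⟩
  · rintro y (rfl | hy)
    · exact hx
    · exact hf.1 y hy
  · rintro y (rfl | hy) z (rfl | hz)
    · simp; linarith
    · exact ⟨(h z hz).1, (h z hz).2.2⟩
    · rw [dist_comm]; have := h y hy; exact ⟨this.2.1, by linarith⟩
    · exact hf.2 y hy z hz

theorem IsKatetov.update {F : Finset U} {f : U → ℝ} {x : U} {r : ℝ} (hf : IsKatetov S (F : Set U) f)
    (hxF : x ∉ F) (hr : r ∈ S) (hpos : 0 < r)
    (h : ∀ z ∈ F, r ≤ dist x z + f z ∧ f z ≤ dist x z + r ∧ dist x z ≤ r + f z) :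
    IsKatetov S ((insert x F : Finset U) : Set U) (Function.update f x r) := by
  have key : ∀ z ∈ F, Function.update f x r z = f z := fun z hz =>
    Function.update_of_ne (by rintro rfl; exact hxF hz) _ _
  rw [Finset.coe_insert]
  refine (hf.congr key).adjoin (by simpa using hr) (by simpa using hpos) fun z hz => ?_
  rw [key z hz, Function.update_self]
  exact h z hz

theorem realizes_insert_update {F : Finset U} {f : U → ℝ} {x y : U} {r : ℝ} (hx : x ∉ F) :
    Realizes (insert x F) (Function.update f x r) y ↔ dist y x = r ∧ Realizes F f y := by
  have key : ∀ z ∈ F, Function.update f x r z = f z := fun z hz =>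
    Function.update_of_ne (by rintro rfl; exact hx hz) _ _
  constructor
  · intro h
    refine ⟨by simpa using h x (Finset.mem_insert_self _ _), fun z hz => ?_⟩
    rw [h z (Finset.mem_insert_of_mem hz), key z hz]
  · rintro ⟨h1, h2⟩ z hz
    rcases Finset.mem_insert.1 hz with rfl | hz'
    · rw [h1, Function.update_self]
    · rw [h2 z hz', key z hz']

theorem Realizes.mono {F F' : Finset U} {f : U → ℝ} {y : U} (h : Realizes F f y) (hF : F' ⊆ F) :
    Realizes F' f y := fun x hx => h x (hF hx)

theorem Realizes.congr {F : Finset U} {f g : U → ℝ} {y : U} (h : Realizes F f y)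
    (hg : ∀ x ∈ F, g x = f x) : Realizes F g y := fun x hx => (h x hx).trans (hg x hx).symm

/-- The distances to a point outside of `W` form a Katětov function on `W`. -/
theorem IsUrysohn.isKatetov_dist (hU : IsUrysohn S U) {W : Set U} {y : U} (hy : y ∉ W) :
    IsKatetov S W (fun z => dist y z) := by
  refine ⟨fun x hx => hU.dist_mem _ _ (by rintro rfl; exact hy hx), fun x _ z _ => ⟨?_, ?_⟩⟩
  · have := dist_triangle y z x; rw [dist_comm x z]; linarith
  · show dist x z ≤ dist y x + dist y z
    have := dist_triangle x y z; rw [dist_comm y x]; linarith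

theorem IsUrysohn.fourValues_insert_zero (hU : IsUrysohn S U) : FourValues (insert 0 S) := by
  have nn : ∀ s ∈ insert 0 S, 0 ≤ s := by
    rintro s (rfl | hs)
    · exact le_rfl
    · exact (hU.pos s hs).le
  rintro a ha b hb a' ha' b' hb' ⟨t, ht, h1, h2, h3, h4⟩
  have na := nn a ha
  have nb := nn b hb
  have na' := nn a' ha'
  have nb' := nn b' hb'
  rw [abs_le] at h1 h3
  rcases ht with rfl | ht
  · refine ⟨max a a', by rcases max_choice a a' with h | h <;> rw [h] <;> assumption, ?_⟩
    have hab : a = b := by linarith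
    have hab' : a' = b' := by linarith
    subst hab hab'
    have : |a - a'| ≤ max a a' := by
      rw [abs_le]; constructor <;> linarith [le_max_left a a', le_max_right a a']
    have h' : max a a' ≤ a + a' := max_le (by linarith) (by linarith)
    exact ⟨this, h', this, h'⟩
  rcases ha with rfl | ha
  · refine ⟨a', ha', by simp [abs_of_nonneg na'], by simp, ?_, ?_⟩
    · rw [abs_le]; constructor <;> linarith
    · linarith
  rcases hb with rfl | hb
  · refine ⟨b', hb', ?_, ?_, by simp [abs_of_nonneg nb'], by simp⟩
    · rw [abs_le]; constructor <;> linarith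
    · linarith
  rcases ha' with rfl | ha'
  · refine ⟨a, Or.inr ha, by simp [abs_of_nonneg na], by simp, ?_, ?_⟩
    · rw [abs_le]; constructor <;> linarith
    · linarith
  rcases hb' with rfl | hb'
  · refine ⟨b, Or.inr hb, ?_, ?_, by simp [abs_of_nonneg nb], by simp⟩
    · rw [abs_le]; constructor <;> linarith
    · linarith
  obtain ⟨u, hu, h⟩ := hU.fourValues a ha b hb a' ha' b' hb'
    ⟨t, ht, abs_le.2 h1, h2, abs_le.2 h3, h4⟩
  exact ⟨u, Or.inr hu, h⟩

theorem IsUrysohn.dist_mem_insert (hU : IsUrysohn S U) (x y : U) : dist x y ∈ insert 0 S := by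
  by_cases h : x = y
  · left; simp [h]
  · exact Or.inr (hU.dist_mem x y h)

theorem exists_mem_max_le {T : Set ℝ} (hT : T.Finite) {m t : ℝ} (ht : t ∈ T) (htm : t ≤ m) :
    ∃ g ∈ T, g ≤ m ∧ ∀ v ∈ T, v ≤ m → v ≤ g := by
  obtain ⟨g, hg, hmax⟩ := Set.exists_max_image {v ∈ T | v ≤ m} id
    (hT.subset (Set.sep_subset _ _)) ⟨t, ht, htm⟩
  exact ⟨g, hg.1, hg.2, fun v hv hvm => hmax v ⟨hv, hvm⟩⟩

/-- A Katětov function on an arbitrary subset extends to the whole space, with values as large as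
possible. -/
theorem IsUrysohn.exists_isKatetov_extension (hU : IsUrysohn S U) {W : Set U} {f : U → ℝ}
    (hf : IsKatetov S W f) :
    ∃ g, IsKatetov S Set.univ g ∧ (∀ w ∈ W, g w = f w) ∧
      ∀ r ∈ S, ∀ u, (∀ w ∈ W, r ≤ f w + dist u w) → r ≤ g u := by
  rcases W.eq_empty_or_nonempty with rfl | hW
  · obtain ⟨M, hM, hmax⟩ := Set.exists_max_image S id hU.finite hU.nonempty
    have hMpos := hU.pos M hM
    refine ⟨fun _ => M, ⟨fun _ _ => hM, fun x _ y _ => ⟨by simp, ?_⟩⟩, by simp,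
      fun r hr u _ => hmax r hr⟩
    rcases hU.dist_mem_insert x y with h | h
    · rw [h]; linarith
    · have := hmax _ h; simp only [id] at this; linarith
  have hT : (insert 0 S).Finite := hU.finite.insert 0
  have h4 := hU.fourValues_insert_zero
  have key : ∀ u : U, ∃ g ∈ insert 0 S, ∃ w ∈ W, g ≤ f w + dist u w ∧
      (∀ v ∈ insert 0 S, v ≤ f w + dist u w → v ≤ g) ∧
      ∀ w' ∈ W, f w + dist u w ≤ f w' + dist u w' := by
    intro u
    have hfinite : ((fun w => f w + dist u w) '' W).Finite := by
      refine ((hT.prod hT).image fun p : ℝ × ℝ => p.1 + p.2).subset ?_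
      rintro _ ⟨w, hw, rfl⟩
      exact ⟨(f w, dist u w), ⟨Or.inr (hf.1 w hw), hU.dist_mem_insert _ _⟩, rfl⟩
    obtain ⟨_, ⟨w, hw, rfl⟩, hmin⟩ := Set.exists_min_image _ id hfinite (hW.image _)
    obtain ⟨g, hg, hgm, hgmax⟩ := exists_mem_max_le hT (Or.inr (hf.1 w hw))
      (le_add_of_nonneg_right (dist_nonneg (x := u) (y := w)))
    exact ⟨g, hg, w, hw, hgm, hgmax, fun w' hw' => hmin _ ⟨w', hw', rfl⟩⟩
  choose g hgS ω hω hgle hgmax hmin using key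
  have low : ∀ u, ∀ w ∈ W, f w ≤ g u + dist u w ∧ dist u w ≤ f w + g u := by
    intro u w hw
    have h1 := hf.2 w hw _ (hω u)
    have h2 := hf.2 _ (hω u) w hw
    have d1 := dist_triangle w (ω u) u
    have d2 := dist_triangle (ω u) w u
    have d3 := dist_triangle w u (ω u)
    simp only [dist_comm _ u, dist_comm (ω u) w] at *
    obtain ⟨v, hv, e1, e2, e3, e4⟩ := h4 (f w) (Or.inr (hf.1 w hw)) (f (ω u))
      (Or.inr (hf.1 _ (hω u))) (dist u w) (hU.dist_mem_insert _ _) (dist u (ω u))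
      (hU.dist_mem_insert _ _) ⟨dist w (ω u), hU.dist_mem_insert _ _,
        abs_le.2 ⟨by linarith, by linarith⟩, by linarith, abs_le.2 ⟨by linarith, by linarith⟩,
        by linarith⟩
    have hvg := hgmax u v hv e4
    rw [abs_le] at e1
    constructor <;> linarith
  have gpos : ∀ u, g u ∈ S := by
    intro u
    have h1 := hgmax u _ (Or.inr (hf.1 _ (hω u))) (le_add_of_nonneg_right dist_nonneg)
    have h2 := hU.pos _ (hf.1 _ (hω u))
    rcases hgS u with h | h
    · linarith
    · exact h
  refine ⟨g, ⟨fun u _ => gpos u, fun u' _ u _ => ?_⟩, fun w hw => le_antisymm ?_ ?_,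
    fun r hr u h => hgmax u r (Or.inr hr) (h _ (hω u))⟩
  · have h1 := low u' _ (hω u)
    have h2 := hmin u' _ (hω u)
    have h3 := hgle u'
    have d1 := dist_triangle u (ω u) u'
    have d2 := dist_triangle (ω u) u u'
    have d3 := dist_triangle u u' (ω u)
    simp only [dist_comm (ω u) _, dist_comm u u'] at *
    obtain ⟨v, hv, e1, e2, e3, e4⟩ := h4 (f (ω u)) (Or.inr (hf.1 _ (hω u))) (g u') (hgS u')
      (dist u (ω u)) (hU.dist_mem_insert _ _) (dist u' u) (hU.dist_mem_insert _ _)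
      ⟨dist u' (ω u), hU.dist_mem_insert _ _,
        abs_le.2 ⟨by linarith, by linarith⟩, by linarith, abs_le.2 ⟨by linarith, by linarith⟩,
        by linarith⟩
    have hvg := hgmax u v hv e2
    rw [abs_le] at e3
    constructor <;> linarith
  · have h1 := hmin w w hw
    have h2 := hgle w
    simp at h1; linarith
  · refine hgmax w _ (Or.inr (hf.1 w hw)) ?_
    have := (hf.2 w hw _ (hω w)).1
    linarith

/-- An invariant of finite partial maps that can be kept while enlarging the domain by any point
is, on arbitrarily large finite sets, satisfied by the restrictions of a single total map. -/
theorem exists_forth {α β γ : Type*} [Countable α] (Inv : Finset α → (α → β) → γ → Prop)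
    {A₀ : Finset α} {φ₀ : α → β} {c₀ : γ} (h₀ : Inv A₀ φ₀ c₀)
    (step : ∀ A φ c, Inv A φ c → ∀ v ∉ A, ∃ ψ c', Inv (insert v A) ψ c' ∧ ∀ a ∈ A, ψ a = φ a) :
    ∃ Φ : α → β, ∀ B : Finset α, ∃ A φ c, B ⊆ A ∧ Inv A φ c ∧ ∀ a ∈ A, Φ a = φ a := by
  rcases isEmpty_or_nonempty α with hα | hα
  · exact ⟨φ₀, fun B => ⟨A₀, φ₀, c₀, fun a => hα.elim a, h₀, fun a => hα.elim a⟩⟩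
  obtain ⟨e, he⟩ := exists_surjective_nat α
  let P := {p : Finset α × (α → β) × γ // Inv p.1 p.2.1 p.2.2}
  have next : ∀ (p : P) (v : α), ∃ q : P, v ∈ q.1.1 ∧ p.1.1 ⊆ q.1.1 ∧
      ∀ a ∈ p.1.1, q.1.2.1 a = p.1.2.1 a := by
    rintro ⟨⟨A, φ, c⟩, h⟩ v
    by_cases hv : v ∈ A
    · exact ⟨⟨⟨A, φ, c⟩, h⟩, hv, subset_rfl, fun _ _ => rfl⟩
    · obtain ⟨ψ, c', h', hψ⟩ := step A φ c h v hv
      exact ⟨⟨⟨insert v A, ψ, c'⟩, h'⟩, Finset.mem_insert_self _ _, Finset.subset_insert _ _, hψ⟩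
  choose nxt hmem hsub hagree using next
  let s : ℕ → P := fun n => Nat.rec ⟨⟨A₀, φ₀, c₀⟩, h₀⟩ (fun n p => nxt p (e n)) n
  have hs : ∀ n, s (n + 1) = nxt (s n) (e n) := fun n => rfl
  have hmono : ∀ n m, n ≤ m → (s n).1.1 ⊆ (s m).1.1 ∧
      ∀ a ∈ (s n).1.1, (s m).1.2.1 a = (s n).1.2.1 a := by
    intro n m hnm
    induction m, hnm using Nat.le_induction with
    | base => exact ⟨subset_rfl, fun _ _ => rfl⟩
    | succ m hm ih =>
      rw [hs]
      exact ⟨ih.1.trans (hsub _ _), fun a ha => (hagree _ _ a (ih.1 ha)).trans (ih.2 a ha)⟩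
  have hex : ∀ a, ∃ n, a ∈ (s n).1.1 := by
    intro a
    obtain ⟨n, rfl⟩ := he a
    exact ⟨n + 1, by rw [hs]; exact hmem _ _⟩
  choose N hN using hex
  have hΦ : ∀ n, ∀ a ∈ (s n).1.1, (s (N a)).1.2.1 a = (s n).1.2.1 a := by
    intro n a ha
    rcases le_total (N a) n with h | h
    · exact ((hmono _ _ h).2 a (hN a)).symm
    · exact (hmono _ _ h).2 a ha
  refine ⟨fun a => (s (N a)).1.2.1 a, fun B => ?_⟩
  refine ⟨(s (B.sup N)).1.1, (s (B.sup N)).1.2.1, (s (B.sup N)).1.2.2, fun a ha => ?_,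
    (s (B.sup N)).2, hΦ _⟩
  exact (hmono _ _ (Finset.le_sup ha)).1 (hN a)

/-- An isometric copy of the Urysohn space has the extension property. -/
theorem IsUrysohn.hasExtension_range (hU : IsUrysohn S U) {φ : U → U} (hφ : Isometry φ) :
    HasExtension S (Set.range φ) := by
  intro F hF f hf
  have hpre : ∀ x ∈ F.preimage φ hφ.injective.injOn, φ x ∈ F := fun x hx => by simpa using hx
  obtain ⟨y, -, hy⟩ := hU.hasExtension (F.preimage φ hφ.injective.injOn) (Set.subset_univ _)
    (fun x => f (φ x)) ⟨fun x hx => hf.1 _ (hpre x hx), fun x hx y hy => by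
      rw [← hφ.dist_eq]; exact hf.2 _ (hpre x hx) _ (hpre y hy)⟩
  refine ⟨φ y, ⟨y, rfl⟩, fun x hx => ?_⟩
  obtain ⟨x, rfl⟩ := hF hx
  rw [hφ.dist_eq]
  exact hy x (by simpa using hx)

/-- Any isometry from `A` whose image lies in a set of distances coming from a point `v` outside
of `A` transports the distances to `v` to a Katětov function on the image. -/
theorem IsUrysohn.exists_isKatetov_image (hU : IsUrysohn S U) {A : Finset U} {φ : U → U}
    (hφ : ∀ a ∈ A, ∀ b ∈ A, dist (φ a) (φ b) = dist a b) {v : U} (hv : v ∉ A) :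
    ∃ g, IsKatetov S (A.image φ : Set U) g ∧ ∀ a ∈ A, g (φ a) = dist v a := by
  have : Nonempty U := ⟨v⟩
  have hinj : Set.InjOn φ A := fun a ha b hb h => by
    rw [← dist_eq_zero, ← hφ a ha b hb, h, dist_self]
  have hg : ∀ a ∈ A, dist v (Function.invFunOn φ A (φ a)) = dist v a := fun a ha => by
    rw [hinj.leftInvOn_invFunOn ha]
  have hk := hU.isKatetov_dist (W := (A : Set U)) (by simpa using hv)
  refine ⟨fun z => dist v (Function.invFunOn φ A z), ⟨?_, ?_⟩, hg⟩
  · intro x hx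
    obtain ⟨a, ha, rfl⟩ := Finset.mem_image.1 (Finset.mem_coe.1 hx)
    simp only [hg a ha]
    exact hk.1 a ha
  · intro x hx y hy
    obtain ⟨a, ha, rfl⟩ := Finset.mem_image.1 (Finset.mem_coe.1 hx)
    obtain ⟨b, hb, rfl⟩ := Finset.mem_image.1 (Finset.mem_coe.1 hy)
    simp only [hg a ha, hg b hb, hφ a ha b hb]
    exact hk.2 a ha b hb

theorem dist_image_insert {A : Finset U} {φ ψ : U → U} {v : U}
    (hφ : ∀ a ∈ A, ∀ b ∈ A, dist (φ a) (φ b) = dist a b) (hψ : ∀ a ∈ A, ψ a = φ a)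
    (hv : ∀ a ∈ A, dist (ψ v) (φ a) = dist v a) :
    ∀ a ∈ insert v A, ∀ b ∈ insert v A, dist (ψ a) (ψ b) = dist a b := by
  intro a ha b hb
  rcases Finset.mem_insert.1 ha with rfl | ha' <;> rcases Finset.mem_insert.1 hb with rfl | hb'
  · simp
  · rw [hψ b hb', hv b hb']
  · rw [hψ a ha', dist_comm, hv a ha', dist_comm]
  · rw [hψ a ha', hψ b hb', hφ a ha' b hb']

/-- Fusion: a condition `J F C` that can be preserved while realizing any Katětov function over `F`
leads to a set with the extension property all of whose points pass through `J`. -/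
theorem IsUrysohn.exists_fusion (hU : IsUrysohn S U) (J : Finset U → Set U → Prop) {F₀ : Finset U}
    {C₀ : Set U} (h₀ : J F₀ C₀)
    (step : ∀ F C, J F C → ∀ g, IsKatetov S (F : Set U) g →
      ∃ y C', Realizes F g y ∧ J (insert y F) C') :
    ∃ C' : Set U, HasExtension S C' ∧ (F₀ : Set U) ⊆ C' ∧ ∀ x ∈ C', ∃ F C, J F C ∧ x ∈ F := by
  have := hU.countable
  obtain ⟨Φ, hΦ⟩ := exists_forth (α := U) (β := U) (γ := Set U)
    (fun A φ C => F₀ ⊆ A ∧ (∀ a ∈ F₀, φ a = a) ∧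
      (∀ a ∈ A, ∀ b ∈ A, dist (φ a) (φ b) = dist a b) ∧ J (A.image φ) C)
    (A₀ := F₀) (φ₀ := id) (c₀ := C₀) ⟨subset_rfl, fun _ _ => rfl, fun _ _ _ _ => rfl, by simpa⟩ (by
      rintro A φ C ⟨h1, h2, h3, h4⟩ v hv
      obtain ⟨g, hg, hgφ⟩ := hU.exists_isKatetov_image h3 hv
      obtain ⟨y, C', hy, hJ⟩ := step _ _ h4 g hg
      have hψ : ∀ a ∈ A, Function.update φ v y a = φ a := fun a ha =>
        Function.update_of_ne (by rintro rfl; exact hv ha) _ _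
      refine ⟨Function.update φ v y, C', ⟨h1.trans (Finset.subset_insert _ _),
        fun a ha => (hψ a (h1 ha)).trans (h2 a ha), dist_image_insert h3 hψ fun a ha => ?_, ?_⟩, hψ⟩
      · rw [Function.update_self, hy _ (Finset.mem_image_of_mem φ ha), hgφ a ha]
      · rw [Finset.image_insert, Function.update_self, Finset.image_congr hψ]
        exact hJ)
  have hiso : Isometry Φ := by
    refine Isometry.of_dist_eq fun a b => ?_
    obtain ⟨A, φ, C, hB, ⟨-, -, h3, -⟩, hA⟩ := hΦ {a, b}
    have ha := hB (Finset.mem_insert_self a {b})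
    have hb := hB (Finset.mem_insert_of_mem (Finset.mem_singleton_self b))
    rw [hA a ha, hA b hb, h3 a ha b hb]
  refine ⟨Set.range Φ, hU.hasExtension_range hiso, fun x hx => ⟨x, ?_⟩, ?_⟩
  · obtain ⟨A, φ, C, -, ⟨h1, h2, -, -⟩, hA⟩ := hΦ ∅
    rw [hA x (h1 hx), h2 x hx]
  · rintro _ ⟨x, rfl⟩
    obtain ⟨A, φ, C, hB, ⟨-, -, -, h4⟩, hA⟩ := hΦ {x}
    have hx := hB (Finset.mem_singleton_self x)
    exact ⟨_, C, h4, by rw [hA x hx]; exact Finset.mem_image_of_mem φ hx⟩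

/-- The Urysohn space embeds into any set with the extension property, over a finite set `B`,
with prescribed distances to a further point `z`. -/
theorem IsUrysohn.exists_embedding (hU : IsUrysohn S U) {C : Set U} (hC : HasExtension S C)
    {B : Finset U} (hB : (B : Set U) ⊆ C) {z : U} (hz : z ∈ C) (hzB : z ∉ B) {D : U → ℝ}
    (hD : IsKatetov S Set.univ D) (hDB : ∀ b ∈ B, D b = dist z b) :
    ∃ φ : U → U, Isometry φ ∧ (∀ b ∈ B, φ b = b) ∧ (∀ v, φ v ∈ C) ∧ ∀ v, dist z (φ v) = D v := by
  have := hU.countable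
  obtain ⟨Φ, hΦ⟩ := exists_forth (α := U) (β := U) (γ := Unit)
    (fun A φ _ => B ⊆ A ∧ (∀ a ∈ B, φ a = a) ∧
      (∀ a ∈ A, ∀ b ∈ A, dist (φ a) (φ b) = dist a b) ∧ ∀ a ∈ A, φ a ∈ C ∧ dist z (φ a) = D a)
    (A₀ := B) (φ₀ := id) (c₀ := ()) ⟨subset_rfl, fun _ _ => rfl, fun _ _ _ _ => rfl,
      fun a ha => ⟨hB ha, (hDB a ha).symm⟩⟩ (by
      rintro A φ C ⟨h1, h2, h3, h4⟩ v hv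
      obtain ⟨g, hg, hgφ⟩ := hU.exists_isKatetov_image h3 hv
      have hzA : z ∉ A.image φ := by
        intro h
        obtain ⟨a, ha, hza⟩ := Finset.mem_image.1 h
        have := hU.pos _ (hD.1 a trivial)
        rw [← (h4 a ha).2, hza, dist_self] at this
        exact lt_irrefl _ this
      obtain ⟨y, hy, hyr⟩ := hC (insert z (A.image φ)) (by
        rw [Finset.coe_insert]
        rintro x (rfl | hx)
        · exact hz
        · obtain ⟨a, ha, rfl⟩ := Finset.mem_image.1 (Finset.mem_coe.1 hx)
          exact (h4 a ha).1) (Function.update g z (D v)) (by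
        refine hg.update hzA (hD.1 v trivial) (hU.pos _ (hD.1 v trivial)) fun u hu => ?_
        obtain ⟨a, ha, rfl⟩ := Finset.mem_image.1 hu
        rw [hgφ a ha, (h4 a ha).2]
        have e1 := hD.2 v trivial a trivial
        have e2 := hD.2 a trivial v trivial
        rw [dist_comm a v] at e2
        exact ⟨by linarith [e1.1], by linarith [e2.2], by linarith [e2.1]⟩)
      obtain ⟨hyz, hyr⟩ := (realizes_insert_update hzA).1 hyr
      have hψ : ∀ a ∈ A, Function.update φ v y a = φ a := fun a ha =>
        Function.update_of_ne (by rintro rfl; exact hv ha) _ _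
      have hyA : ∀ a ∈ A, dist y (φ a) = dist v a := fun a ha => by
        rw [hyr _ (Finset.mem_image_of_mem φ ha), hgφ a ha]
      refine ⟨Function.update φ v y, (), ⟨h1.trans (Finset.subset_insert _ _),
        fun a ha => (hψ a (h1 ha)).trans (h2 a ha), dist_image_insert h3 hψ fun a ha => ?_, ?_⟩, hψ⟩
      · rw [Function.update_self, hyA a ha]
      · intro a ha
        rcases Finset.mem_insert.1 ha with rfl | ha'
        · rw [Function.update_self]
          exact ⟨hy, by rw [dist_comm, hyz]⟩
        · rw [hψ a ha']
          exact h4 a ha')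
  refine ⟨Φ, Isometry.of_dist_eq fun a b => ?_, fun b hb => ?_, fun v => ?_, fun v => ?_⟩
  · obtain ⟨A, φ, C, hB, ⟨-, -, h3, -⟩, hA⟩ := hΦ {a, b}
    have ha := hB (Finset.mem_insert_self a {b})
    have hb := hB (Finset.mem_insert_of_mem (Finset.mem_singleton_self b))
    rw [hA a ha, hA b hb, h3 a ha b hb]
  · obtain ⟨A, φ, C, -, ⟨h1, h2, -, -⟩, hA⟩ := hΦ ∅
    rw [hA b (h1 hb), h2 b hb]
  · obtain ⟨A, φ, C, hB, ⟨-, -, -, h4⟩, hA⟩ := hΦ {v}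
    have hx := hB (Finset.mem_singleton_self v)
    rw [hA v hx]
    exact (h4 v hx).1
  · obtain ⟨A, φ, C, hB, ⟨-, -, -, h4⟩, hA⟩ := hΦ {v}
    have hx := hB (Finset.mem_singleton_self v)
    rw [hA v hx]
    exact (h4 v hx).2

theorem IsUrysohn.exists_removal_point (hU : IsUrysohn S U) {C : Set U} (hC : HasExtension S C)
    {B : Finset U} (hB : (B : Set U) ⊆ C) {z : U} (hz : z ∈ C) (hzB : z ∉ B) {A : Set (U → ℝ)}
    (hA : ∀ a ∈ A, IsKatetov S ((insert z B : Finset U) : Set U) a)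
    (hcross : ∀ a ∈ A, ∀ b ∈ A, ∀ v w, Realizes B a v → Realizes B b w →
      a z ≤ dist v w + b z ∧ dist v w ≤ a z + b z) :
    ∃ C' ⊆ C, HasExtension S C' ∧ (B : Set U) ⊆ C' ∧
      ∀ a ∈ A, ∀ w ∈ C', Realizes B a w → dist w z = a z := by
  obtain ⟨D, hDA, hDB⟩ : ∃ D : U → ℝ, (∀ a ∈ A, ∀ v, Realizes B a v → D v = a z) ∧
      ∀ b ∈ B, D b = dist z b := by
    refine ⟨fun v => if h : ∃ a ∈ A, Realizes B a v then h.choose z else dist z v, ?_, ?_⟩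
    · intro a ha v hv
      have h : ∃ a ∈ A, Realizes B a v := ⟨a, ha, hv⟩
      have h1 := (hcross a ha _ h.choose_spec.1 v v hv h.choose_spec.2).1
      have h2 := (hcross _ h.choose_spec.1 a ha v v h.choose_spec.2 hv).1
      simp only [dif_pos h]
      rw [dist_self] at h1 h2
      linarith
    · intro b hb
      refine dif_neg ?_
      rintro ⟨a, ha, h⟩
      have := hU.pos _ ((hA a ha).1 b (Finset.mem_insert_of_mem hb))
      rw [← h b hb, dist_self] at this
      exact lt_irrefl _ this
  have hzm : z ∈ ((insert z B : Finset U) : Set U) := Finset.mem_insert_self _ _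
  have hbm : ∀ b ∈ B, b ∈ ((insert z B : Finset U) : Set U) := fun b hb =>
    Finset.mem_insert_of_mem hb
  have hK : IsKatetov S ((B : Set U) ∪ {v | ∃ a ∈ A, Realizes B a v}) D := by
    refine ⟨?_, ?_⟩
    · rintro v (hv | ⟨a, ha, hv⟩)
      · rw [hDB v hv]
        exact hU.dist_mem _ _ (by rintro rfl; exact hzB hv)
      · rw [hDA a ha v hv]
        exact (hA a ha).1 z hzm
    · rintro v (hv | ⟨a, ha, hv⟩) w (hw | ⟨b, hb, hw⟩)
      · rw [hDB v hv, hDB w hw]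
        have := dist_triangle_right z v w
        have := dist_triangle_left v w z
        exact ⟨by linarith, by linarith⟩
      · rw [hDB v hv, hDA b hb w hw, dist_comm v w, hw v hv]
        have h1 := (hA b hb).2 z hzm v (hbm v hv)
        have h2 := (hA b hb).2 v (hbm v hv) z hzm
        rw [dist_comm v z] at h2
        exact ⟨by linarith [h1.2], by linarith [h2.1]⟩
      · rw [hDA a ha v hv, hDB w hw, hv w hw]
        have h1 := (hA a ha).2 z hzm w (hbm w hw)
        have h2 := (hA a ha).2 w (hbm w hw) z hzm
        rw [dist_comm w z] at h2
        exact ⟨by linarith [h1.1], by linarith [h2.1]⟩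
      · rw [hDA a ha v hv, hDA b hb w hw]
        exact hcross a ha b hb v w hv hw
  obtain ⟨g, hg, hgW, -⟩ := hU.exists_isKatetov_extension hK
  obtain ⟨φ, hφ, hφB, hφC, hφz⟩ := hU.exists_embedding hC hB hz hzB hg fun b hb => by
    rw [hgW b (Or.inl hb), hDB b hb]
  refine ⟨Set.range φ, Set.range_subset_iff.2 hφC, hU.hasExtension_range hφ,
    fun b hb => ⟨b, hφB b hb⟩, ?_⟩
  rintro a ha _ ⟨v, rfl⟩ hv
  have hv' : Realizes B a v := fun b hb => by
    rw [← hv b hb, ← hφ.dist_eq, hφB b hb]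
  rw [dist_comm, hφz, hgW v (Or.inr ⟨a, ha, hv'⟩), hDA a ha v hv']

/-- The distances to the finite set `E` can be prescribed, inside of a smaller set with the
extension property, for all points realizing over `B` the given types. -/
theorem IsUrysohn.exists_removal (hU : IsUrysohn S U) (B E : Finset U) {C : Set U}
    (hC : HasExtension S C) (hB : (B : Set U) ⊆ C) (hE : (E : Set U) ⊆ C) {A : Set (U → ℝ)}
    (hA : ∀ a ∈ A, IsKatetov S ((B ∪ E : Finset U) : Set U) a)
    (hcross : ∀ a ∈ A, ∀ b ∈ A, ∀ v w, Realizes B a v → Realizes B b w → ∀ z ∈ E,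
      a z ≤ dist v w + b z ∧ dist v w ≤ a z + b z) :
    ∃ C' ⊆ C, HasExtension S C' ∧ (B : Set U) ⊆ C' ∧
      ∀ a ∈ A, ∀ w ∈ C', Realizes B a w → Realizes E a w := by
  induction E using Finset.induction_on generalizing C with
  | empty => exact ⟨C, subset_rfl, hC, hB, fun _ _ _ _ _ => by simp [Realizes]⟩
  | insert z E hzE ih =>
    have hE' : (E : Set U) ⊆ C := fun x hx => hE (Finset.mem_insert_of_mem hx)
    have hsub : B ∪ E ⊆ B ∪ insert z E :=
      Finset.union_subset_union_right (Finset.subset_insert _ _)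
    have hA' : ∀ a ∈ A, IsKatetov S ((B ∪ E : Finset U) : Set U) a := fun a ha =>
      (hA a ha).mono (Finset.coe_subset.2 hsub)
    obtain ⟨C₁, hC₁, hext, hBC₁, h⟩ : ∃ C' ⊆ C, HasExtension S C' ∧
        ((B ∪ E : Finset U) : Set U) ⊆ C' ∧
        ∀ a ∈ A, ∀ w ∈ C', Realizes (B ∪ E) a w → dist w z = a z := by
      by_cases hzB : z ∈ B
      · exact ⟨C, subset_rfl, hC, by simpa using ⟨hB, hE'⟩, fun a _ w _ hw =>
          hw z (Finset.mem_union_left _ hzB)⟩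
      · refine hU.exists_removal_point hC (by simpa using ⟨hB, hE'⟩)
          (hE (Finset.mem_insert_self _ _)) (by simp [hzB, hzE]) (fun a ha => ?_) ?_
        · rw [← Finset.union_insert]
          exact hA a ha
        · exact fun a ha b hb v w hv hw => hcross a ha b hb v w (hv.mono Finset.subset_union_left)
            (hw.mono Finset.subset_union_left) z (Finset.mem_insert_self _ _)
    rw [Finset.coe_union] at hBC₁
    obtain ⟨C₂, hC₂, hext₂, hBC₂, h₂⟩ := ih hext (Set.subset_union_left.trans hBC₁)
      (Set.subset_union_right.trans hBC₁) hA' fun a ha b hb v w hv hw x hx =>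
        hcross a ha b hb v w hv hw x (Finset.mem_insert_of_mem hx)
    refine ⟨C₂, hC₂.trans hC₁, hext₂, hBC₂, fun a ha w hw hwB x hx => ?_⟩
    have hwE := h₂ a ha w hw hwB
    rcases Finset.mem_insert.1 hx with rfl | hx'
    · refine h a ha w (hC₂ hw) fun y hy => ?_
      rcases Finset.mem_union.1 hy with hy | hy
      · exact hwB y hy
      · exact hwE y hy
    · exact hwE x hx'

/-- Every point of `C` of type `f` over `F` lies in `Γ`. -/
def Captured (Γ C : Set U) (F : Finset U) (f : U → ℝ) : Prop := ∀ y ∈ C, Realizes F f y → y ∈ Γ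

theorem Captured.mono {Γ C C' : Set U} {F : Finset U} {f : U → ℝ} (h : Captured Γ C F f)
    (hC : C' ⊆ C) : Captured Γ C' F f := fun y hy => h y (hC hy)

/-- Orbits of rank `r` can be made monochromatic. -/
def HasMono (S : Set ℝ) (U : Type*) [MetricSpace U] (r : ℝ) : Prop :=
  ∀ (Γ C : Set U) (F : Finset U) (p : U → ℝ), HasExtension S C → (F : Set U) ⊆ C →
    IsKatetov S (F : Set U) p → (∀ x ∈ F, r ≤ p x) → (∃ x ∈ F, p x = r) →
    ∃ C' ⊆ C, HasExtension S C' ∧ (F : Set U) ⊆ C' ∧ (Captured Γ C' F p ∨ Captured Γᶜ C' F p)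

theorem IsUrysohn.exists_captured_of_captured (hU : IsUrysohn S U) {Γ C : Set U} {F G : Finset U}
    {q : U → ℝ} {r : ℝ} (hC : HasExtension S C) (hG : (G : Set U) ⊆ C) (hFG : F ⊆ G)
    (hq : IsKatetov S (G : Set U) q) (hqr : ∀ x ∈ G, r ≤ q x) (hx : ∃ x ∈ F, q x = r)
    (hcap : Captured Γ C G q) :
    ∃ C' ⊆ C, HasExtension S C' ∧ (F : Set U) ⊆ C' ∧ Captured Γ C' F q := by
  obtain ⟨x₀, hx₀, hx₀r⟩ := hx
  obtain ⟨C', h1, h2, h3, h4⟩ := hU.exists_removal F G hC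
    ((Finset.coe_subset.2 hFG).trans hG) hG (A := {q}) (by
      rintro a rfl
      rwa [Finset.union_eq_right.2 hFG]) (by
      rintro a rfl b rfl v w hv hw z hz
      have := hqr z hz
      have h1 := hv x₀ hx₀
      have h2 := hw x₀ hx₀
      exact ⟨by linarith [dist_nonneg (x := v) (y := w)],
        by linarith [dist_triangle_right v w x₀]⟩)
  exact ⟨C', h1, h2, h3, fun y hy hyF => hcap y (h1 hy) (h4 q rfl y hy hyF)⟩

/-- Orbits of minimal rank can be made monochromatic. -/
theorem IsUrysohn.hasMono_min (hU : IsUrysohn S U) {r : ℝ} (hmin : ∀ s ∈ S, r ≤ s) :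
    HasMono S U r := by
  intro Γ C F p hC hF hp hpr hpx
  by_cases h : ∀ C' ⊆ C, HasExtension S C' → ∀ G : Finset U, F ⊆ G → (G : Set U) ⊆ C' →
      ∀ q, IsKatetov S (G : Set U) q → (∀ x ∈ F, q x = p x) → ∃ y ∈ C', Realizes G q y ∧ y ∈ Γ
  · obtain ⟨C', h1, h2, h3⟩ := hU.exists_fusion (fun G _ => F ⊆ G ∧ (G : Set U) ⊆ C ∧
      ∀ y ∈ G, Realizes F p y → y ∈ Γ) (F₀ := F) (C₀ := C) ⟨subset_rfl, hF, fun y hy hyF => by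
        have := hU.pos _ (hp.1 y hy)
        rw [← hyF y hy, dist_self] at this
        exact (lt_irrefl _ this).elim⟩ (by
      rintro G C₁ ⟨g1, g2, g3⟩ g hg
      by_cases hgp : ∀ x ∈ F, g x = p x
      · obtain ⟨y, hy, hyG, hyΓ⟩ := h C subset_rfl hC G g1 g2 g hg hgp
        refine ⟨y, C₁, hyG, g1.trans (Finset.subset_insert _ _), ?_, ?_⟩
        · rw [Finset.coe_insert]
          exact Set.insert_subset hy g2
        · intro x hx hxF
          rcases Finset.mem_insert.1 hx with rfl | hx
          · exact hyΓ
          · exact g3 x hx hxF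
      · obtain ⟨y, hy, hyG⟩ := hC G g2 g hg
        refine ⟨y, C₁, hyG, g1.trans (Finset.subset_insert _ _), ?_, ?_⟩
        · rw [Finset.coe_insert]
          exact Set.insert_subset hy g2
        · intro x hx hxF
          rcases Finset.mem_insert.1 hx with rfl | hx
          · exact (hgp fun z hz => by rw [← hyG z (g1 hz), hxF z hz]).elim
          · exact g3 x hx hxF)
    refine ⟨C', fun x hx => ?_, h1, h2, Or.inl fun y hy hyF => ?_⟩
    · obtain ⟨G, _, ⟨-, g2, -⟩, hxG⟩ := h3 x hx
      exact g2 hxG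
    · obtain ⟨G, _, ⟨-, -, g3⟩, hyG⟩ := h3 y hy
      exact g3 y hyG hyF
  · push Not at h
    obtain ⟨C₁, h1, h2, G, hFG, hG, q, hq, hqp, hno⟩ := h
    obtain ⟨x, hx, hxr⟩ := hpx
    obtain ⟨C', h3, h4, h5, h6⟩ := hU.exists_captured_of_captured (Γ := Γᶜ) h2 hG hFG hq
      (fun x hx => hmin _ (hq.1 x hx)) ⟨x, hx, by rw [hqp x hx, hxr]⟩ hno
    exact ⟨C', h3.trans h1, h4, h5, Or.inr fun y hy hyF => h6 y hy (hyF.congr hqp)⟩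

/-- Up to equality on `F`, there are finitely many Katětov functions over `F`. -/
theorem exists_finset_isKatetov (hS : S.Finite) (F : Finset U) :
    ∃ T : Finset (U → ℝ), (∀ h ∈ T, IsKatetov S (F : Set U) h) ∧
      (∀ h ∈ T, ∀ k ∈ T, (∀ x ∈ F, h x = k x) → h = k) ∧
      ∀ f, IsKatetov S (F : Set U) f → ∃ h ∈ T, ∀ x ∈ F, h x = f x := by
  have hfin : {h : U → ℝ | (∀ x ∉ F, h x = 0) ∧ IsKatetov S (F : Set U) h}.Finite := by
    have : (Set.pi Set.univ fun _ : F => S).Finite := Set.Finite.pi fun _ => hS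
    refine Set.Finite.of_finite_image (f := fun h : U → ℝ => fun x : F => h x)
      (this.subset ?_) ?_
    · rintro _ ⟨h, hh, rfl⟩ x -
      exact hh.2.1 x x.2
    · intro h hh k hk hhk
      funext x
      by_cases hx : x ∈ F
      · exact congrFun hhk ⟨x, hx⟩
      · rw [hh.1 x hx, hk.1 x hx]
  refine ⟨hfin.toFinset, fun h hh => ((hfin.mem_toFinset).1 hh).2, fun h hh k hk hhk => ?_,
    fun f hf => ⟨fun x => if x ∈ F then f x else 0, ?_, fun x hx => if_pos hx⟩⟩
  · funext x
    by_cases hx : x ∈ F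
    · exact hhk x hx
    · rw [((hfin.mem_toFinset).1 hh).1 x hx, ((hfin.mem_toFinset).1 hk).1 x hx]
  · exact (hfin.mem_toFinset).2 ⟨fun x hx => if_neg hx, hf.congr fun x hx => if_pos hx⟩

/-- All orbits of rank `r` over `F` can be made monochromatic simultaneously. -/
theorem IsUrysohn.exists_captured_all (hU : IsUrysohn S U) {r : ℝ} (hr : HasMono S U r)
    (Γ : Set U) {C : Set U} {F : Finset U} (hC : HasExtension S C) (hF : (F : Set U) ⊆ C) :
    ∃ C' ⊆ C, HasExtension S C' ∧ (F : Set U) ⊆ C' ∧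
      ∀ f, IsKatetov S (F : Set U) f → (∀ x ∈ F, r ≤ f x) → (∃ x ∈ F, f x = r) →
        Captured Γ C' F f ∨ Captured Γᶜ C' F f := by
  obtain ⟨T, hT, -, hTall⟩ := exists_finset_isKatetov hU.finite F
  have : ∀ T' ⊆ T, ∃ C' ⊆ C, HasExtension S C' ∧ (F : Set U) ⊆ C' ∧
      ∀ f ∈ T', (∀ x ∈ F, r ≤ f x) → (∃ x ∈ F, f x = r) →
        Captured Γ C' F f ∨ Captured Γᶜ C' F f := by
    intro T' hT'
    induction T' using Finset.induction_on with
    | empty => exact ⟨C, subset_rfl, hC, hF, by simp⟩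
    | insert f T' hf ih =>
      obtain ⟨C₁, h1, h2, h3, h4⟩ := ih ((Finset.subset_insert _ _).trans hT')
      by_cases hfr : (∀ x ∈ F, r ≤ f x) ∧ ∃ x ∈ F, f x = r
      · obtain ⟨C₂, g1, g2, g3, g4⟩ := hr Γ C₁ F f h2 h3 (hT f (hT' (Finset.mem_insert_self _ _)))
          hfr.1 hfr.2
        refine ⟨C₂, g1.trans h1, g2, g3, fun k hk hk1 hk2 => ?_⟩
        rcases Finset.mem_insert.1 hk with rfl | hk
        · exact g4
        · exact (h4 k hk hk1 hk2).imp (fun h => h.mono g1) fun h => h.mono g1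
      · refine ⟨C₁, h1, h2, h3, fun k hk hk1 hk2 => ?_⟩
        rcases Finset.mem_insert.1 hk with rfl | hk
        · exact (hfr ⟨hk1, hk2⟩).elim
        · exact h4 k hk hk1 hk2
  obtain ⟨C', h1, h2, h3, h4⟩ := this T subset_rfl
  refine ⟨C', h1, h2, h3, fun f hf hf1 hf2 => ?_⟩
  obtain ⟨h, hhT, hhf⟩ := hTall f hf
  obtain ⟨x, hx, hxr⟩ := hf2
  exact (h4 h hhT (fun x hx => by rw [hhf x hx]; exact hf1 x hx)
    ⟨x, hx, by rw [hhf x hx, hxr]⟩).imp (fun hc y hy hyF => hc y hy (hyF.congr hhf))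
    fun hc y hy hyF => hc y hy (hyF.congr hhf)

/-- `h` extends `p` over `G`, has rank at least `r`, and differs from `g` by at most `r'`. -/
structure IsRelevant (S : Set ℝ) (r' r : ℝ) (F : Finset U) (p : U → ℝ) (G : Finset U)
    (g h : U → ℝ) : Prop where
  isKatetov : IsKatetov S (G : Set U) h
  eq : ∀ x ∈ F, h x = p x
  le : ∀ x ∈ G, r ≤ h x
  abs_sub_le : ∀ x ∈ G, |h x - g x| ≤ r'

/-- Over any finite set and any type `g`, there is a point that is at distance `r'` only from
points of `Γ` among those of the relevant types for `g`. -/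
def HasApproach (S : Set ℝ) (r' r : ℝ) (Γ : Set U) (F : Finset U) (p : U → ℝ) (C : Set U) : Prop :=
  ∀ C' ⊆ C, HasExtension S C' → ∀ G : Finset U, F ⊆ G → (G : Set U) ⊆ C' →
    ∀ g, IsKatetov S (G : Set U) g → (∃ h, IsRelevant S r' r F p G g h) →
    ∃ C'' ⊆ C', HasExtension S C'' ∧ (G : Set U) ⊆ C'' ∧ ∃ x ∈ C'',
      (∀ z ∈ G, r ≤ dist x z) ∧ (∀ z ∈ G, |g z - dist x z| ≤ r') ∧
      (∀ h, IsRelevant S r' r F p G g h → ∀ z ∈ G, |h z - dist x z| ≤ r') ∧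
      ∀ h, IsRelevant S r' r F p G g h → ∀ w ∈ C'', Realizes G h w → dist w x = r' → w ∈ Γ

theorem IsKatetov.update_of_abs_sub_le {F : Finset U} {f : U → ℝ} {x : U} {r' : ℝ}
    (hf : IsKatetov S (F : Set U) f) (hxF : x ∉ F) (hr : r' ∈ S) (hpos : 0 < r')
    (h : ∀ z ∈ F, |f z - dist x z| ≤ r' ∧ r' ≤ dist x z + f z) :
    IsKatetov S ((insert x F : Finset U) : Set U) (Function.update f x r') := by
  refine hf.update hxF hr hpos fun z hz => ?_
  obtain ⟨h1, h2⟩ := h z hz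
  rw [abs_le] at h1
  exact ⟨h2, by linarith, by linarith⟩

theorem IsUrysohn.exists_captured_of_hasApproach (hU : IsUrysohn S U) {r' r : ℝ} (hr'S : r' ∈ S)
    (hr : r' < r) (hcons : ∀ s ∈ S, s < r → s ≤ r') {Γ C : Set U} {F : Finset U} {p : U → ℝ}
    (hC : HasExtension S C) (hF : (F : Set U) ⊆ C) (hp : IsKatetov S (F : Set U) p)
    (hpr : ∀ x ∈ F, r ≤ p x) (happ : HasApproach S r' r Γ F p C) :
    ∃ C' ⊆ C, HasExtension S C' ∧ (F : Set U) ⊆ C' ∧ Captured Γ C' F p := by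
  have hr' := hU.pos r' hr'S
  obtain ⟨C', h1, h2, h3⟩ := hU.exists_fusion (fun G C' => F ⊆ G ∧ (G : Set U) ⊆ C' ∧ C' ⊆ C ∧
      HasExtension S C' ∧ (∀ y ∈ G, Realizes F p y → y ∈ Γ) ∧
      ∀ h, IsKatetov S (G : Set U) h → (∀ x ∈ F, h x = p x) → (∃ x ∈ G, h x < r) →
        Captured Γ C' G h) (F₀ := F) (C₀ := C) ⟨subset_rfl, hF, subset_rfl, hC, fun y hy hyF => by
      have := hU.pos _ (hp.1 y hy)
      rw [← hyF y hy, dist_self] at this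
      exact (lt_irrefl _ this).elim, fun h hh hhp ⟨x, hx, hxr⟩ => by
      rw [hhp x hx] at hxr
      exact absurd (hpr x hx) (not_le.2 hxr)⟩ (by
    rintro G C' ⟨hFG, hG, hC', hext, hΓ, hcap⟩ g hg
    have hself : (∀ x ∈ F, g x = p x) → (∀ x ∈ G, r ≤ g x) → IsRelevant S r' r F p G g g :=
      fun h1 h2 => ⟨hg, h1, h2, fun x _ => by simpa using hr'.le⟩
    have hrel : ∀ y h, Realizes G g y → IsKatetov S ((insert y G : Finset U) : Set U) h →
        (∀ x ∈ F, h x = p x) → (∀ x ∈ G, r ≤ h x) → h y ≤ r' → IsRelevant S r' r F p G g h := by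
      intro y h hy hh hhp hhr hhy
      refine ⟨hh.mono (Finset.coe_subset.2 (Finset.subset_insert _ _)), hhp, hhr, fun x hx => ?_⟩
      have hx' : x ∈ ((insert y G : Finset U) : Set U) := Finset.mem_insert_of_mem hx
      have hy' : y ∈ ((insert y G : Finset U) : Set U) := Finset.mem_insert_self _ _
      have e1 := hh.2 x hx' y hy'
      rw [dist_comm, hy x hx] at e1
      rw [abs_le]
      exact ⟨by linarith [e1.2], by linarith [e1.1]⟩
    by_cases hex : ∃ h, IsRelevant S r' r F p G g h
    · obtain ⟨C₂, hC₂, hext₂, hG₂, x, hx, hxr, hgx, hhx, hxΓ⟩ := happ C' hC' hext G hFG hG g hg hex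
      have hxG : x ∉ G := fun h => by
        have := hxr x h
        rw [dist_self] at this
        linarith
      obtain ⟨y, hy, hyr⟩ := hext₂ (insert x G) (by
        rw [Finset.coe_insert]
        exact Set.insert_subset hx hG₂) _ (hg.update_of_abs_sub_le hxG hr'S hr' fun z hz =>
          ⟨hgx z hz, by linarith [hxr z hz, hU.pos _ (hg.1 z hz)]⟩)
      obtain ⟨hyx, hyG⟩ := (realizes_insert_update hxG).1 hyr
      have hxy : x ∉ insert y G := by
        rw [Finset.mem_insert]
        rintro (rfl | h)
        · rw [dist_self] at hyx
          linarith
        · exact hxG h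
      have hyGC : ((insert y G : Finset U) : Set U) ⊆ C₂ := by
        rw [Finset.coe_insert]
        exact Set.insert_subset hy hG₂
      obtain ⟨C₃, hC₃, hext₃, hG₃, hrem⟩ := hU.exists_removal (insert y G) {x} hext₂ hyGC
        (by simpa using hx) (A := {a | IsKatetov S ((insert y G ∪ {x} : Finset U) : Set U) a ∧
          a x = r' ∧ a y ≤ r'}) (fun a ha => ha.1) (by
          rintro a ⟨-, ha1, ha2⟩ b ⟨-, hb1, hb2⟩ v w hv hw z hz
          rw [Finset.mem_singleton.1 hz, ha1, hb1]
          have e1 := hv y (Finset.mem_insert_self _ _)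
          have e2 := hw y (Finset.mem_insert_self _ _)
          exact ⟨by linarith [dist_nonneg (x := v) (y := w)],
            by linarith [dist_triangle_right v w y]⟩)
      refine ⟨y, C₃, hyG, hFG.trans (Finset.subset_insert _ _), hG₃,
        hC₃.trans (hC₂.trans hC'), hext₃, ?_, ?_⟩
      · intro z hz hzF
        rcases Finset.mem_insert.1 hz with rfl | hz
        · have hgp : ∀ x ∈ F, g x = p x := fun x hx => by rw [← hyG x (hFG hx), hzF x hx]
          by_cases hgr : ∀ x ∈ G, r ≤ g x
          · exact hxΓ g (hself hgp hgr) z hy hyG hyx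
          · push Not at hgr
            exact hcap g hg hgp hgr z (hC₂ hy) hyG
        · exact hΓ z hz hzF
      · intro h hh hhp hhr w hw hwr
        have hhG : IsKatetov S (G : Set U) h :=
          hh.mono (Finset.coe_subset.2 (Finset.subset_insert _ _))
        have hwG := hwr.mono (Finset.subset_insert y G)
        by_cases hhr' : ∀ x ∈ G, r ≤ h x
        · obtain ⟨z, hz, hzr⟩ := hhr
          have hhy : h y ≤ r' := by
            rcases Finset.mem_insert.1 hz with rfl | hz
            · exact hcons _ (hh.1 _ (Finset.mem_insert_self _ _)) hzr
            · exact absurd (hhr' z hz) (not_le.2 hzr)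
          have hhrel := hrel y h hyG hh hhp hhr' hhy
          have hup : ∀ z ∈ insert y G, Function.update h x r' z = h z := fun z hz =>
            Function.update_of_ne (by rintro rfl; exact hxy hz) _ _
          refine hxΓ h hhrel w (hC₃ hw) hwG ?_
          have := hrem (Function.update h x r') ⟨?_, Function.update_self _ _ _, ?_⟩ w hw
            (hwr.congr hup) x (Finset.mem_singleton_self x)
          · rw [this, Function.update_self]
          · rw [Finset.union_comm, Finset.singleton_union]
            refine hh.update_of_abs_sub_le hxy hr'S hr' fun z hz => ?_
            have hpos := hU.pos _ (hh.1 z hz)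
            rcases Finset.mem_insert.1 hz with rfl | hz
            · rw [dist_comm, hyx, abs_le]
              exact ⟨⟨by linarith, by linarith⟩, by linarith⟩
            · exact ⟨hhx h hhrel z hz, by linarith [hxr z hz]⟩
          · rw [hup y (Finset.mem_insert_self _ _)]
            exact hhy
        · push Not at hhr'
          exact hcap h hhG hhp hhr' w (hC₂ (hC₃ hw)) hwG
    · obtain ⟨y, hy, hyG⟩ := hext G hG g hg
      refine ⟨y, C', hyG, hFG.trans (Finset.subset_insert _ _), ?_, hC', hext, ?_, ?_⟩
      · rw [Finset.coe_insert]
        exact Set.insert_subset hy hG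
      · intro z hz hzF
        rcases Finset.mem_insert.1 hz with rfl | hz
        · have hgp : ∀ x ∈ F, g x = p x := fun x hx => by rw [← hyG x (hFG hx), hzF x hx]
          by_cases hgr : ∀ x ∈ G, r ≤ g x
          · exact (hex ⟨g, hself hgp hgr⟩).elim
          · push Not at hgr
            exact hcap g hg hgp hgr z hy hyG
        · exact hΓ z hz hzF
      · intro h hh hhp hhr w hw hwr
        by_cases hhr' : ∀ x ∈ G, r ≤ h x
        · obtain ⟨z, hz, hzr⟩ := hhr
          rcases Finset.mem_insert.1 hz with rfl | hz
          · exact (hex ⟨h, hrel z h hyG hh hhp hhr'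
              (hcons _ (hh.1 _ (Finset.mem_insert_self _ _)) hzr)⟩).elim
          · exact absurd (hhr' z hz) (not_le.2 hzr)
        · push Not at hhr'
          exact hcap h (hh.mono (Finset.coe_subset.2 (Finset.subset_insert _ _))) hhp hhr' w hw
            (hwr.mono (Finset.subset_insert y G)))
  refine ⟨C', fun x hx => ?_, h1, h2, fun y hy hyF => ?_⟩
  · obtain ⟨G, C₁, ⟨-, g2, g3, -⟩, hxG⟩ := h3 x hx
    exact g3 (g2 hxG)
  · obtain ⟨G, C₁, ⟨-, -, -, -, g5, -⟩, hyG⟩ := h3 y hy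
    exact g5 y hyG hyF

/-- A variant of `HasApproach` for types of rank at least `r` that are close to `p`. -/
def HasCenter (S : Set ℝ) (r' r : ℝ) (Γ : Set U) (F : Finset U) (p : U → ℝ) (C : Set U) : Prop :=
  ∀ C' ⊆ C, HasExtension S C' → ∀ G : Finset U, F ⊆ G → (G : Set U) ⊆ C' →
    ∀ q, IsKatetov S (G : Set U) q → (∀ x ∈ G, r ≤ q x) →
    ∃ C'' ⊆ C', HasExtension S C'' ∧ (G : Set U) ⊆ C'' ∧ ∃ x ∈ C'', Realizes G q x ∧
      ∀ w ∈ C'', Realizes F p w → (∀ z ∈ G, r ≤ dist w z) → dist w x = r' → w ∈ Γ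

theorem IsKatetov.max {W : Set U} {g : U → ℝ} {r : ℝ} (hg : IsKatetov S W g) (hrS : r ∈ S) :
    IsKatetov S W fun x => max (g x) r := by
  refine ⟨fun x hx => ?_, fun x hx y hy => ?_⟩
  · rcases max_choice (g x) r with h | h <;> simp only [h]
    exacts [hg.1 x hx, hrS]
  · have h1 := hg.2 x hx y hy
    have := dist_nonneg (x := x) (y := y)
    refine ⟨max_le ?_ ?_, ?_⟩
    · linarith [le_max_left (g y) r]
    · linarith [le_max_right (g y) r]
    · linarith [le_max_left (g y) r, le_max_left (g x) r]

theorem HasCenter.hasApproach {r' r : ℝ} (hrS : r ∈ S) {Γ C : Set U}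
    {F : Finset U} {p : U → ℝ} (h : HasCenter S r' r Γ F p C) : HasApproach S r' r Γ F p C := by
  rintro C' hC' hext G hFG hG g hg ⟨h₀, hh₀⟩
  have hle : ∀ h, IsRelevant S r' r F p G g h → ∀ z ∈ G, |h z - max (g z) r| ≤ r' := by
    intro h hh z hz
    have h1 := abs_le.1 (hh.abs_sub_le z hz)
    have h2 := hh.le z hz
    rw [abs_le]
    rcases max_cases (g z) r with ⟨e, e'⟩ | ⟨e, e'⟩ <;> rw [e] <;> constructor <;> linarith
  obtain ⟨C₂, hC₂, hext₂, hG₂, x, hx, hxG, hxΓ⟩ := h C' hC' hext G hFG hG _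
    (hg.max hrS) fun _ _ => le_max_right _ _
  refine ⟨C₂, hC₂, hext₂, hG₂, x, hx, fun z hz => ?_, fun z hz => ?_, fun h hh z hz => ?_,
    fun h hh w hw hwG hwx => ?_⟩
  · rw [hxG z hz]
    exact le_max_right _ _
  · rw [hxG z hz]
    have h1 := abs_le.1 (hh₀.abs_sub_le z hz)
    have h2 := hh₀.le z hz
    rw [abs_le]
    rcases max_cases (g z) r with ⟨e, e'⟩ | ⟨e, e'⟩ <;> simp only [e] <;> constructor <;> linarith
  · rw [hxG z hz]
    exact hle h hh z hz
  · exact hxΓ w hw (fun z hz => by rw [hwG z (hFG hz), hh.eq z hz])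
      (fun z hz => by rw [hwG z hz]; exact hh.le z hz) hwx

theorem IsKatetov.union {W W' : Set U} {f : U → ℝ} (hf : IsKatetov S W f) (hf' : IsKatetov S W' f)
    (h : ∀ e ∈ W', ∀ z ∈ W, f e ≤ dist e z + f z ∧ f z ≤ dist e z + f e ∧ dist e z ≤ f e + f z) :
    IsKatetov S (W ∪ W') f := by
  refine ⟨?_, ?_⟩
  · rintro x (hx | hx)
    exacts [hf.1 x hx, hf'.1 x hx]
  · rintro x (hx | hx) y (hy | hy)
    · exact hf.2 x hx y hy
    · have := h y hy x hx
      rw [dist_comm x y]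
      exact ⟨this.2.1, by linarith⟩
    · exact ⟨(h x hx y hy).1, (h x hx y hy).2.2⟩
    · exact hf'.2 x hx y hy

/-- Two distances that are `r'`-close to a third one are close to each other. -/
theorem IsUrysohn.exists_abs_sub_le (hU : IsUrysohn S U) {a b c r' : ℝ} (ha : a ∈ S) (hb : b ∈ S)
    (hc : c ∈ S) (hr' : r' ∈ S) (har : r' ≤ a + c) (hbr : r' ≤ b + c) (hac : |a - c| ≤ r')
    (hbc : |b - c| ≤ r') : ∃ u ∈ S, |a - b| ≤ u ∧ u ≤ 2 * r' := by
  rw [abs_le] at hac hbc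
  obtain ⟨u, hu, h1, -, -, h2⟩ := hU.fourValues a ha r' hr' b hb r' hr'
    ⟨c, hc, abs_le.2 ⟨by linarith, by linarith⟩, by linarith, abs_le.2 ⟨by linarith, by linarith⟩,
      by linarith⟩
  exact ⟨u, hu, h1, by linarith⟩

/-- Over any extension `q` of `p` of rank at least `r` there is a point of type `q` that is at
distance `r'` only from points of `Γ` among those of type `q`. -/
def HasLocalCenter (S : Set ℝ) (r' r : ℝ) (Γ : Set U) (F : Finset U) (p : U → ℝ)
    (C : Set U) : Prop :=
  ∀ C' ⊆ C, HasExtension S C' → ∀ G : Finset U, F ⊆ G → (G : Set U) ⊆ C' →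
    ∀ q, IsKatetov S (G : Set U) q → (∀ x ∈ F, q x = p x) → (∀ x ∈ G, r ≤ q x) →
    ∃ C'' ⊆ C', HasExtension S C'' ∧ (G : Set U) ⊆ C'' ∧ ∃ x ∈ C'', Realizes G q x ∧
      ∀ w ∈ C'', Realizes G q w → dist w x = r' → w ∈ Γ

/-- In `C` there are points `ξ h` of type `h` over `G`, for `h ∈ T`, at mutual distance `R`, such
that the points of type `h` at distance `r'` from `ξ h` and `R` from the other ones lie in `Γ`. -/
structure IsCenterSystem (r' R : ℝ) (Γ : Set U) (G : Finset U) (T : Finset (U → ℝ)) (C : Set U)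
    (ξ : (U → ℝ) → U) : Prop where
  mem : ∀ h ∈ T, ξ h ∈ C
  realizes : ∀ h ∈ T, Realizes G h (ξ h)
  dist_eq : ∀ h ∈ T, ∀ k ∈ T, h ≠ k → dist (ξ h) (ξ k) = R
  captured : ∀ h ∈ T, ∀ w ∈ C, Realizes G h w → dist w (ξ h) = r' →
    (∀ k ∈ T, k ≠ h → dist w (ξ k) = R) → w ∈ Γ

theorem Realizes.notMem {F : Finset U} {f : U → ℝ} {y : U} (h : Realizes F f y)
    (hf : ∀ x ∈ F, 0 < f x) : y ∉ F := fun hy => by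
  have := hf y hy
  rw [← h y hy, dist_self] at this
  exact lt_irrefl _ this

theorem IsUrysohn.exists_isCenterSystem (hU : IsUrysohn S U) {r' r R : ℝ} (hr' : 0 < r')
    (hr : r' < r) (hRS : R ∈ S) (hrR : r ≤ R) (hR2 : R ≤ 2 * r') {Γ C : Set U} {F : Finset U}
    {p : U → ℝ} (hloc : HasLocalCenter S r' r Γ F p C) {C' : Set U} (hC' : C' ⊆ C)
    (hext : HasExtension S C') {G : Finset U} (hFG : F ⊆ G) (hG : (G : Set U) ⊆ C')
    (T : Finset (U → ℝ)) (hT : ∀ h ∈ T, IsKatetov S (G : Set U) h)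
    (hTp : ∀ h ∈ T, ∀ x ∈ F, h x = p x) (hTr : ∀ h ∈ T, ∀ x ∈ G, r ≤ h x)
    (hTR : ∀ h ∈ T, ∀ k ∈ T, ∀ x ∈ G, |h x - k x| ≤ R) :
    ∃ C'' ⊆ C', HasExtension S C'' ∧ (G : Set U) ⊆ C'' ∧ ∃ ξ, IsCenterSystem r' R Γ G T C'' ξ := by
  have hnot : ∀ h ∈ T, ∀ y, Realizes G h y → y ∉ G := fun h hh y hy =>
    hy.notMem fun x hx => by linarith [hTr h hh x hx]
  suffices H : ∀ T' ⊆ T, ∃ C'' ⊆ C', HasExtension S C'' ∧ (G : Set U) ⊆ C'' ∧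
      ∃ ξ, IsCenterSystem r' R Γ G T' C'' ξ from H T subset_rfl
  intro T' hT'
  induction T' using Finset.induction_on with
  | empty =>
    obtain ⟨M, hM⟩ := hU.nonempty
    obtain ⟨y, -⟩ := hext ∅ (by simp) (fun _ => M) ⟨by simp, by simp⟩
    exact ⟨C', subset_rfl, hext, hG, fun _ => y, by simp, by simp, by simp, by simp⟩
  | insert h T' hhT' ih =>
    obtain ⟨C₂, hC₂, hext₂, hG₂, ξ, hξ⟩ := ih ((Finset.subset_insert _ _).trans hT')
    have hh : h ∈ T := hT' (Finset.mem_insert_self _ _)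
    have hsub : ∀ k ∈ T', k ∈ T := fun k hk => hT' (Finset.mem_insert_of_mem hk)
    have hξG : ∀ k ∈ T', ξ k ∉ G := fun k hk => hnot k (hsub k hk) _ (hξ.realizes k hk)
    obtain ⟨q, hqG, hqξ⟩ : ∃ q : U → ℝ, (∀ z ∈ G, q z = h z) ∧ ∀ k ∈ T', q (ξ k) = R :=
      ⟨fun z => if z ∈ G then h z else R, fun z hz => if_pos hz, fun k hk => if_neg (hξG k hk)⟩
    have hK : IsKatetov S ((G : Set U) ∪ ξ '' (T' : Set (U → ℝ))) q := by
      refine ((hT h hh).congr hqG).union ⟨?_, ?_⟩ ?_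
      · rintro _ ⟨k, hk, rfl⟩
        simp only [hqξ k hk, hRS]
      · rintro _ ⟨k, hk, rfl⟩ _ ⟨l, hl, rfl⟩
        simp only [hqξ k hk, hqξ l hl]
        refine ⟨by linarith [dist_nonneg (x := ξ k) (y := ξ l)], ?_⟩
        by_cases hkl : k = l
        · rw [hkl, dist_self]
          linarith
        · rw [hξ.dist_eq k hk l hl hkl]
          linarith
      · rintro _ ⟨k, hk, rfl⟩ z hz
        simp only [hqξ k hk, hqG z hz, hξ.realizes k hk z hz]
        have e1 := hTr h hh z hz
        have e2 := hTr k (hsub k hk) z hz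
        have e3 := abs_le.1 (hTR h hh k (hsub k hk) z hz)
        exact ⟨by linarith, by linarith, by linarith⟩
    obtain ⟨C₃, hC₃, hext₃, hG₃, x, hx, hxr, hxΓ⟩ := hloc C₂ (hC₂.trans hC') hext₂
      (G ∪ T'.image ξ) (hFG.trans Finset.subset_union_left) (by
        rw [Finset.coe_union]
        refine Set.union_subset hG₂ ?_
        rintro z hz
        obtain ⟨k, hk, rfl⟩ := Finset.mem_image.1 (Finset.mem_coe.1 hz)
        exact hξ.mem k hk) _ (by simpa using hK) (fun z hz => by
        rw [← hTp h hh z hz]; exact hqG z (hFG hz)) (fun z hz => by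
        rcases Finset.mem_union.1 hz with hz | hz
        · simp only [hqG z hz]; exact hTr h hh z hz
        · obtain ⟨k, hk, rfl⟩ := Finset.mem_image.1 hz
          simp only [hqξ k hk, hrR])
    have hGsub : (G : Set U) ⊆ C₃ := fun z hz => hG₃ (Finset.mem_union_left _ hz)
    have hup : ∀ k ∈ T', Function.update ξ h x k = ξ k := fun k hk =>
      Function.update_of_ne (by rintro rfl; exact hhT' hk) _ _
    have hmem : ∀ k ∈ T', ξ k ∈ G ∪ T'.image ξ := fun k hk =>
      Finset.mem_union_right _ (Finset.mem_image_of_mem ξ hk)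
    have hxξ : ∀ k ∈ T', dist x (ξ k) = R := fun k hk => by
      rw [hxr _ (hmem k hk), hqξ k hk]
    refine ⟨C₃, hC₃.trans hC₂, hext₃, hGsub, Function.update ξ h x, ?_, ?_, ?_, ?_⟩
    · intro k hk
      rcases Finset.mem_insert.1 hk with rfl | hk
      · rwa [Function.update_self]
      · rw [hup k hk]
        exact hG₃ (hmem k hk)
    · intro k hk
      rcases Finset.mem_insert.1 hk with rfl | hk
      · rw [Function.update_self]
        exact fun z hz => by rw [hxr z (Finset.mem_union_left _ hz), hqG z hz]
      · rw [hup k hk]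
        exact hξ.realizes k hk
    · intro k hk l hl hkl
      rcases Finset.mem_insert.1 hk with rfl | hk' <;> rcases Finset.mem_insert.1 hl with rfl | hl'
      · exact (hkl rfl).elim
      · rw [Function.update_self, hup l hl', hxξ l hl']
      · rw [Function.update_self, hup k hk', dist_comm, hxξ k hk']
      · rw [hup k hk', hup l hl', hξ.dist_eq k hk' l hl' hkl]
    · intro k hk w hw hwG hwk hwT
      rcases Finset.mem_insert.1 hk with rfl | hk'
      · rw [Function.update_self] at hwk
        refine hxΓ w hw (fun z hz => ?_) hwk
        rcases Finset.mem_union.1 hz with hz | hz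
        · rw [hwG z hz, hqG z hz]
        · obtain ⟨l, hl, rfl⟩ := Finset.mem_image.1 hz
          rw [hqξ l hl, ← hup l hl]
          exact hwT l (Finset.mem_insert_of_mem hl) (by rintro rfl; exact hhT' hl)
      · rw [hup k hk'] at hwk
        refine hξ.captured k hk' w (hC₃ hw) hwG hwk fun l hl hlk => ?_
        rw [← hup l hl]
        exact hwT l (Finset.mem_insert_of_mem hl) hlk

theorem HasLocalCenter.hasCenter (hU : IsUrysohn S U) {r' r R : ℝ} (hr'S : r' ∈ S)
    (hr : r' < r) (hRS : R ∈ S) (hrR : r ≤ R) (hR2 : R ≤ 2 * r')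
    (hRmax : ∀ s ∈ S, s ≤ 2 * r' → s ≤ R)
    (hstar : ∀ a ∈ S, ∀ b ∈ S, ∀ s ∈ S, r ≤ a → a < b → b ≤ a + s → R ≤ r' + s)
    {Γ C : Set U} {F : Finset U} {p : U → ℝ} (hloc : HasLocalCenter S r' r Γ F p C) :
    HasCenter S r' r Γ F p C := by
  intro C' hC' hext G hFG hG q hq hqr
  have hr' := hU.pos r' hr'S
  obtain ⟨T₀, hT₀, hT₀inj, hT₀all⟩ := exists_finset_isKatetov hU.finite G
  obtain ⟨T, hTdef⟩ : ∃ T : Finset (U → ℝ), ∀ h, h ∈ T ↔ h ∈ T₀ ∧ (∀ x ∈ F, h x = p x) ∧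
    (∀ x ∈ G, r ≤ h x) ∧ ∀ x ∈ G, |h x - q x| ≤ r' := ⟨T₀.filter _, fun h => Finset.mem_filter⟩
  have hT : ∀ h ∈ T, IsKatetov S (G : Set U) h := fun h hh => hT₀ h ((hTdef h).1 hh).1
  have hTr : ∀ h ∈ T, ∀ x ∈ G, r ≤ h x := fun h hh => ((hTdef h).1 hh).2.2.1
  have hTq : ∀ h ∈ T, ∀ x ∈ G, |h x - q x| ≤ r' := fun h hh => ((hTdef h).1 hh).2.2.2
  have hTR : ∀ h ∈ T, ∀ k ∈ T, ∀ x ∈ G, |h x - k x| ≤ R := by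
    intro h hh k hk x hx
    have e1 := hTr h hh x hx
    have e2 := hTr k hk x hx
    have e3 := hqr x hx
    obtain ⟨u, hu, h1, h2⟩ := hU.exists_abs_sub_le ((hT h hh).1 x hx) ((hT k hk).1 x hx)
      (hq.1 x hx) hr'S (by linarith) (by linarith) (hTq h hh x hx) (hTq k hk x hx)
    exact h1.trans (hRmax u hu h2)
  obtain ⟨C₂, hC₂, hext₂, hG₂, ξ, hξ⟩ := hU.exists_isCenterSystem hr' hr hRS hrR hR2 hloc hC' hext
    hFG hG T hT (fun h hh => ((hTdef h).1 hh).2.1) hTr hTR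
  have hξG : ∀ k ∈ T, ξ k ∉ G := fun k hk => (hξ.realizes k hk).notMem fun x hx => by
    linarith [hTr k hk x hx]
  have hE : ((T.image ξ : Finset U) : Set U) ⊆ C₂ := by
    intro z hz
    obtain ⟨k, hk, rfl⟩ := Finset.mem_image.1 (Finset.mem_coe.1 hz)
    exact hξ.mem k hk
  have hξξ : ∀ k ∈ T, ∀ l ∈ T, dist (ξ k) (ξ l) ≤ R := fun k hk l hl => by
    by_cases hkl : k = l
    · rw [hkl, dist_self]
      linarith
    · rw [hξ.dist_eq k hk l hl hkl]
  have hξne : ∀ k ∈ T, ∀ l ∈ T, k ≠ l → ξ k ≠ ξ l := fun k hk l hl hkl h => by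
    have := hξ.dist_eq k hk l hl hkl
    rw [h, dist_self] at this
    linarith
  obtain ⟨x, hx, hxG, hxξ⟩ : ∃ x ∈ C₂, Realizes G q x ∧ ∀ k ∈ T, dist x (ξ k) = r' := by
    obtain ⟨f, hqG, hqξ⟩ : ∃ f : U → ℝ, (∀ z ∈ G, f z = q z) ∧ ∀ k ∈ T, f (ξ k) = r' :=
      ⟨fun z => if z ∈ G then q z else r', fun z hz => if_pos hz, fun k hk => if_neg (hξG k hk)⟩
    have hK : IsKatetov S ((G : Set U) ∪ ξ '' (T : Set (U → ℝ))) f := by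
      refine (hq.congr hqG).union ⟨?_, ?_⟩ ?_
      · rintro _ ⟨k, hk, rfl⟩
        simp only [hqξ k hk, hr'S]
      · rintro _ ⟨k, hk, rfl⟩ _ ⟨l, hl, rfl⟩
        simp only [hqξ k hk, hqξ l hl]
        exact ⟨by linarith [dist_nonneg (x := ξ k) (y := ξ l)], by linarith [hξξ k hk l hl]⟩
      · rintro _ ⟨k, hk, rfl⟩ z hz
        simp only [hqξ k hk, hqG z hz, hξ.realizes k hk z hz]
        have e1 := hqr z hz
        have e2 := hTr k hk z hz
        have e3 := abs_le.1 (hTq k hk z hz)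
        exact ⟨by linarith, by linarith, by linarith⟩
    obtain ⟨x, hx, hxr⟩ := hext₂ (G ∪ T.image ξ) (by
      rw [Finset.coe_union]; exact Set.union_subset hG₂ hE) _ (by simpa using hK)
    refine ⟨x, hx, fun z hz => ?_, fun k hk => ?_⟩
    · rw [hxr z (Finset.mem_union_left _ hz), hqG z hz]
    · rw [hxr _ (Finset.mem_union_right _ (Finset.mem_image_of_mem ξ hk)), hqξ k hk]
  have hxnG : x ∉ G := hxG.notMem fun z hz => by linarith [hqr z hz]
  have hxnξ : ∀ k ∈ T, ξ k ≠ x := fun k hk h => by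
    have := hxξ k hk
    rw [h, dist_self] at this
    linarith
  obtain ⟨α, hαG, hαx, hαξ, hαne⟩ : ∃ α : (U → ℝ) → U → ℝ, (∀ h, ∀ z ∈ G, α h z = h z) ∧
      (∀ h, α h x = r') ∧ (∀ h ∈ T, α h (ξ h) = r') ∧
      ∀ h ∈ T, ∀ k ∈ T, k ≠ h → α h (ξ k) = R := by
    refine ⟨fun h z => if z ∈ G then h z else if z = x then r' else if z = ξ h then r' else R,
      fun h z hz => by simp [hz], fun h => by simp [hxnG], fun h hh => by simp [hξG h hh],
      fun h hh k hk hkh => by simp [hξG k hk, hxnξ k hk, hξne k hk h hh hkh]⟩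
  have hαcases : ∀ h ∈ T, ∀ k ∈ T, α h (ξ k) = r' ∨ α h (ξ k) = R := fun h hh k hk => by
    by_cases hkh : k = h
    · exact Or.inl (hkh ▸ hαξ k hk)
    · exact Or.inr (hαne h hh k hk hkh)
  have hαbd : ∀ h ∈ T, ∀ k ∈ T, r' ≤ α h (ξ k) ∧ α h (ξ k) ≤ R := fun h hh k hk => by
    rcases hαcases h hh k hk with e | e <;> rw [e] <;> constructor <;> linarith
  have hsubx : ((insert x G : Finset U) : Set U) ⊆ C₂ := by
    rw [Finset.coe_insert]
    exact Set.insert_subset hx hG₂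
  obtain ⟨C₃, hC₃, hext₃, hG₃, hrem⟩ := hU.exists_removal (insert x G) (T.image ξ) hext₂ hsubx hE
    (A := {a | ∃ h ∈ T, a = α h}) (by
      rintro _ ⟨h, hh, rfl⟩
      rw [Finset.coe_union]
      refine IsKatetov.union ?_ ⟨?_, ?_⟩ ?_
      · rw [Finset.coe_insert]
        refine ((hT h hh).congr (hαG h)).adjoin (by rw [hαx]; exact hr'S) (by rwa [hαx])
          fun z hz => ?_
        rw [hαx, hαG h z hz, hxG z hz]
        have e1 := hqr z hz
        have e2 := hTr h hh z hz
        have e3 := abs_le.1 (hTq h hh z hz)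
        exact ⟨by linarith, by linarith, by linarith⟩
      · intro z hz
        obtain ⟨k, hk, rfl⟩ := Finset.mem_image.1 (Finset.mem_coe.1 hz)
        rcases hαcases h hh k hk with e | e <;> rw [e] <;> assumption
      · intro z hz z' hz'
        obtain ⟨k, hk, rfl⟩ := Finset.mem_image.1 (Finset.mem_coe.1 hz)
        obtain ⟨l, hl, rfl⟩ := Finset.mem_image.1 (Finset.mem_coe.1 hz')
        by_cases hkl : k = l
        · rw [hkl, dist_self]
          have := hαbd h hh l hl
          exact ⟨by linarith, by linarith⟩
        · rw [hξ.dist_eq k hk l hl hkl]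
          have e1 := hαbd h hh l hl
          have e2 := hαbd h hh k hk
          exact ⟨by linarith, by linarith⟩
      · intro z hz y hy
        obtain ⟨k, hk, rfl⟩ := Finset.mem_image.1 (Finset.mem_coe.1 hz)
        have e1 := hαbd h hh k hk
        rcases Finset.mem_insert.1 (Finset.mem_coe.1 hy) with rfl | hy
        · rw [hαx, dist_comm, hxξ k hk]
          exact ⟨by linarith, by linarith, by linarith⟩
        · rw [hαG h y hy, hξ.realizes k hk y hy]
          have e2 := hTr h hh y hy
          have e3 := hTr k hk y hy
          by_cases hkh : k = h
          · rw [hkh, hαξ h hh]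
            exact ⟨by linarith, by linarith, by linarith⟩
          · rw [hαne h hh k hk hkh]
            have e4 := abs_le.1 (hTR h hh k hk y hy)
            exact ⟨by linarith, by linarith, by linarith⟩) (by
      rintro _ ⟨h, hh, rfl⟩ _ ⟨k, hk, rfl⟩ v w hv hw z hz
      obtain ⟨l, hl, rfl⟩ := Finset.mem_image.1 hz
      have hvx := hv x (Finset.mem_insert_self _ _)
      have hwx := hw x (Finset.mem_insert_self _ _)
      rw [hαx] at hvx hwx
      have hvw : dist v w ≤ 2 * r' := by linarith [dist_triangle_right v w x]
      have b1 := hαbd h hh l hl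
      have b2 := hαbd k hk l hl
      refine ⟨?_, by linarith⟩
      by_cases hhk : h = k
      · rw [hhk]
        linarith [dist_nonneg (x := v) (y := w)]
      · suffices R ≤ r' + dist v w by linarith
        obtain ⟨y, hy, hyne⟩ : ∃ y ∈ G, h y ≠ k y := by
          by_contra! hcon
          exact hhk (hT₀inj h ((hTdef h).1 hh).1 k ((hTdef k).1 hk).1 hcon)
        have hvy := hv y (Finset.mem_insert_of_mem hy)
        have hwy := hw y (Finset.mem_insert_of_mem hy)
        rw [hαG _ y hy] at hvy hwy
        have hne : v ≠ w := by
          rintro rfl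
          exact hyne (hvy.symm.trans hwy)
        have hs := hU.dist_mem v w hne
        have d1 := dist_triangle v w y
        have d2 := dist_triangle_left w y v
        rcases lt_or_gt_of_ne hyne with hlt | hlt
        · exact hstar _ ((hT h hh).1 y hy) _ ((hT k hk).1 y hy) _ hs (hTr h hh y hy) hlt
            (by linarith)
        · exact hstar _ ((hT k hk).1 y hy) _ ((hT h hh).1 y hy) _ hs (hTr k hk y hy) hlt
            (by linarith))
  refine ⟨C₃, hC₃.trans hC₂, hext₃, fun z hz => hG₃ (Finset.mem_insert_of_mem hz), x,
    hG₃ (Finset.mem_insert_self _ _), hxG, fun w hw hwF hwr hwx => ?_⟩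
  have hwnG : w ∉ G := fun h => by
    have := hwr w h
    rw [dist_self] at this
    linarith
  obtain ⟨h, hh, hhw⟩ := hT₀all _ (hU.isKatetov_dist (W := (G : Set U)) (by simpa using hwnG))
  have hhT : h ∈ T := by
    refine (hTdef h).2 ⟨hh, fun z hz => ?_, fun z hz => ?_, fun z hz => ?_⟩
    · rw [hhw z (hFG hz), hwF z hz]
    · rw [hhw z hz]
      exact hwr z hz
    · rw [hhw z hz, ← hxG z hz, ← hwx]
      exact abs_dist_sub_le w x z
  have hwE := hrem (α h) ⟨h, hhT, rfl⟩ w hw fun z hz => by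
    rcases Finset.mem_insert.1 hz with rfl | hz
    · rw [hwx, hαx]
    · rw [hαG h z hz, hhw z hz]
  refine hξ.captured h hhT w (hC₃ hw) (fun z hz => (hhw z hz).symm) ?_ fun k hk hkh => ?_
  · rw [hwE _ (Finset.mem_image_of_mem ξ hhT), hαξ h hhT]
  · rw [hwE _ (Finset.mem_image_of_mem ξ hk), hαne h hhT k hk hkh]

theorem IsUrysohn.exists_captured_of_extension (hU : IsUrysohn S U) {r' r : ℝ} (hr'S : r' ∈ S)
    (hr : r' < r) (hcons : ∀ s ∈ S, s < r → s ≤ r') {Γ C : Set U} {F G : Finset U} {p q : U → ℝ}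
    (hC : HasExtension S C) (hG : (G : Set U) ⊆ C) (hFG : F ⊆ G) (hq : IsKatetov S (G : Set U) q)
    (hqr : ∀ x ∈ G, r ≤ q x) (hqp : ∀ x ∈ F, q x = p x) (hx : ∃ x ∈ F, p x = r)
    (happ : HasApproach S r' r Γ G q C) :
    ∃ C' ⊆ C, HasExtension S C' ∧ (F : Set U) ⊆ C' ∧ Captured Γ C' F p := by
  obtain ⟨C₁, h1, h2, h3, h4⟩ := hU.exists_captured_of_hasApproach hr'S hr hcons hC hG hq hqr happ
  obtain ⟨x, hx, hxr⟩ := hx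
  obtain ⟨C₂, g1, g2, g3, g4⟩ := hU.exists_captured_of_captured h2 h3 hFG hq hqr
    ⟨x, hx, by rw [hqp x hx, hxr]⟩ h4
  exact ⟨C₂, g1.trans h1, g2, g3, fun y hy hyF => g4 y hy (hyF.congr hqp)⟩

theorem IsUrysohn.hasCenter_compl (hU : IsUrysohn S U) {r' r : ℝ} (hr'S : r' ∈ S) (hrS : r ∈ S)
    (hr : r' < r) (hr2 : r ≤ 2 * r') (hmono : HasMono S U r') {Γ C : Set U} {G : Finset U}
    {q : U → ℝ} (hno : ∀ C' ⊆ C, HasExtension S C' → (G : Set U) ⊆ C' → ∀ x ∈ C', Realizes G q x →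
      ∃ w ∈ C', Realizes G q w ∧ dist w x = r' ∧ w ∉ Γ) : HasCenter S r' r Γᶜ G q C := by
  intro C' hC' hext G' hGG' hG' q' hq' hqr'
  have hr' := hU.pos r' hr'S
  obtain ⟨x, hx, hxG⟩ := hext G' hG' q' hq'
  have hxn : x ∉ G' := hxG.notMem fun z hz => by linarith [hqr' z hz]
  have hsub : ((insert x G' : Finset U) : Set U) ⊆ C' := by
    rw [Finset.coe_insert]
    exact Set.insert_subset hx hG'
  obtain ⟨C₂, hC₂, hext₂, hG₂, hall⟩ := hU.exists_captured_all hmono Γ hext hsub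
  have hxC₂ := hG₂ (Finset.mem_insert_self x G')
  have hG'C₂ : (G' : Set U) ⊆ C₂ := fun z hz => hG₂ (Finset.mem_insert_of_mem hz)
  refine ⟨C₂, hC₂, hext₂, hG'C₂, x, hxC₂, hxG, fun w hw hwG hwr hwx => ?_⟩
  have hwlb : ∀ z ∈ insert x G', r' ≤ dist w z := fun z hz => by
    rcases Finset.mem_insert.1 hz with rfl | hz
    · exact hwx.ge
    · linarith [hwr z hz]
  have hwn : w ∉ insert x G' := fun h => by
    have := hwlb w h
    rw [dist_self] at this
    linarith
  have hK := hU.isKatetov_dist (W := ((insert x G' : Finset U) : Set U)) (by exact_mod_cast hwn)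
  rcases hall _ hK hwlb ⟨x, Finset.mem_insert_self _ _, hwx⟩ with hcap | hcap
  · exfalso
    obtain ⟨y, hy, hyr⟩ := hext₂ _ hG₂ _ (hK.max hrS)
    have hyn : y ∉ insert x G' := hyr.notMem fun z _ => lt_max_of_lt_right (by linarith)
    have hyw : ∀ z ∈ G', dist y z = dist w z := fun z hz => by
      rw [hyr z (Finset.mem_insert_of_mem hz)]
      exact max_eq_left (hwr z hz)
    have hyx : dist y x = r := by
      rw [hyr x (Finset.mem_insert_self _ _)]
      exact max_eq_right (by rw [hwx]; exact hr.le)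
    have hyG : y ∉ G := fun h => hyn (Finset.mem_insert_of_mem (hGG' h))
    have hup : ∀ z ∈ insert x G', Function.update (fun z => dist w z) y r' z = dist w z :=
      fun z hz => Function.update_of_ne (by rintro rfl; exact hyn hz) _ _
    have hGC₂ : (G : Set U) ⊆ C₂ := (Finset.coe_subset.2 hGG').trans hG'C₂
    obtain ⟨C₃, hC₃, hext₃, hG₃, hrem⟩ := hU.exists_removal (insert y G) (insert x G') hext₂
      (by rw [Finset.coe_insert]; exact Set.insert_subset hy hGC₂) hG₂
      (A := {Function.update (fun z => dist w z) y r'}) (by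
        rintro _ rfl
        have : insert y G ∪ insert x G' = insert y (insert x G') := by
          rw [Finset.insert_union, Finset.union_eq_right.2
            (hGG'.trans (Finset.subset_insert _ _))]
        rw [this]
        refine hK.update_of_abs_sub_le hyn hr'S hr' fun z hz => ?_
        refine ⟨?_, by linarith [hwlb z hz, dist_nonneg (x := y) (y := z)]⟩
        rcases Finset.mem_insert.1 hz with rfl | hz
        · simp only [hwx, hyx, abs_le]
          constructor <;> linarith
        · simp only [hyw z hz, sub_self, abs_zero, hr'.le]) (by
        rintro _ rfl _ rfl v v' hv hv' z hz
        have e1 := hv y (Finset.mem_insert_self _ _)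
        have e2 := hv' y (Finset.mem_insert_self _ _)
        rw [Function.update_self] at e1 e2
        rw [hup z hz]
        have e3 := hwlb z hz
        exact ⟨by linarith [dist_nonneg (x := v) (y := v')],
          by linarith [dist_triangle_right v v' y]⟩)
    have hyC₃ := hG₃ (Finset.mem_insert_self y G)
    obtain ⟨v, hv, hvG, hvy, hvΓ⟩ := hno C₃ (hC₃.trans (hC₂.trans hC')) hext₃
      (fun z hz => hG₃ (Finset.mem_insert_of_mem hz)) y hyC₃ fun z hz => by
        rw [hyw z (hGG' hz), hwG z hz]
    refine hvΓ (hcap v (hC₃ hv) fun z hz => ?_)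
    rw [hrem _ rfl v hv (fun z hz => ?_) z hz, hup z hz]
    rcases Finset.mem_insert.1 hz with rfl | hz
    · rw [hvy, Function.update_self]
    · rw [hup z (Finset.mem_insert_of_mem (hGG' hz)), hvG z hz, hwG z hz]
  · exact hcap w hw fun z _ => rfl

/-- Orbits of rank `r` inherit monochromaticity from the preceding rank `r' ≥ r / 2`. -/
theorem IsUrysohn.hasMono_of_le_two_mul (hU : IsUrysohn S U) {r' r R : ℝ} (hr'S : r' ∈ S)
    (hrS : r ∈ S) (hr : r' < r) (hcons : ∀ s ∈ S, s < r → s ≤ r') (hRS : R ∈ S) (hrR : r ≤ R)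
    (hR2 : R ≤ 2 * r') (hRmax : ∀ s ∈ S, s ≤ 2 * r' → s ≤ R)
    (hstar : ∀ a ∈ S, ∀ b ∈ S, ∀ s ∈ S, r ≤ a → a < b → b ≤ a + s → R ≤ r' + s)
    (hmono : HasMono S U r') : HasMono S U r := by
  intro Γ C F p hC hF hp hpr hpx
  by_cases hloc : HasLocalCenter S r' r Γ F p C
  · obtain ⟨C', h1, h2, h3, h4⟩ := hU.exists_captured_of_extension hr'S hr hcons hC hF subset_rfl hp
      hpr (fun _ _ => rfl) hpx ((hloc.hasCenter hU hr'S hr hRS hrR hR2 hRmax hstar).hasApproach hrS)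
    exact ⟨C', h1, h2, h3, Or.inl h4⟩
  · unfold HasLocalCenter at hloc
    push Not at hloc
    obtain ⟨C₁, hC₁, hext₁, G, hFG, hG, q, hq, hqp, hqr, hno⟩ := hloc
    obtain ⟨C', h1, h2, h3, h4⟩ := hU.exists_captured_of_extension hr'S hr hcons hext₁ hG hFG hq hqr
      hqp hpx ((hU.hasCenter_compl hr'S hrS hr (hrR.trans hR2) hmono hno).hasApproach hrS)
    exact ⟨C', h1.trans hC₁, h2, h3, Or.inr h4⟩

/-- `q'` extends the type `q` over `G` to a type of rank at least `r` over a subset `G'` of a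
smaller set `C'` with the extension property. -/
structure IsBelow (S : Set ℝ) (r : ℝ) (q : U → ℝ) (G : Finset U) (C : Set U) (q' : U → ℝ)
    (G' : Finset U) (C' : Set U) : Prop where
  subset : C' ⊆ C
  hasExtension : HasExtension S C'
  le : G ⊆ G'
  mem : (G' : Set U) ⊆ C'
  isKatetov : IsKatetov S (G' : Set U) q'
  eq : ∀ x ∈ G, q' x = q x
  le_rank : ∀ x ∈ G', r ≤ q' x

theorem IsBelow.trans {r : ℝ} {q q' q'' : U → ℝ} {G G' G'' : Finset U} {C C' C'' : Set U}
    (h' : IsBelow S r q' G' C' q'' G'' C'') (h : IsBelow S r q G C q' G' C') :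
    IsBelow S r q G C q'' G'' C'' :=
  ⟨h'.subset.trans h.subset, h'.hasExtension, h.le.trans h'.le, h'.mem, h'.isKatetov,
    fun x hx => (h'.eq x (h.le hx)).trans (h.eq x hx), h'.le_rank⟩

/-- Some point of type `q` over `G` is at distance `r'` only from points of `Γ` among those of
type `h` over `B`. -/
def IsGood (S : Set ℝ) (r' : ℝ) (Γ : Set U) (h : U → ℝ) (B : Finset U) (q : U → ℝ) (G : Finset U)
    (C : Set U) : Prop :=
  ∃ C' ⊆ C, HasExtension S C' ∧ (G : Set U) ⊆ C' ∧ ∃ x ∈ C', Realizes G q x ∧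
    ∀ w ∈ C', Realizes B h w → dist w x = r' → w ∈ Γ

theorem IsGood.of_isBelow {r' r : ℝ} {Γ : Set U} {h : U → ℝ} {B : Finset U} {q q' : U → ℝ}
    {G G' : Finset U} {C C' : Set U} (hg : IsGood S r' Γ h B q' G' C')
    (hb : IsBelow S r q G C q' G' C') : IsGood S r' Γ h B q G C := by
  obtain ⟨C₁, h1, h2, h3, x, hx, hxr, hxΓ⟩ := hg
  exact ⟨C₁, h1.trans hb.subset, h2, (Finset.coe_subset.2 hb.le).trans h3, x, hx,
    fun z hz => by rw [hxr z (hb.le hz), hb.eq z hz], hxΓ⟩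

/-- A distance that is close to a distance at least `r` is itself at least `r`. -/
theorem le_of_abs_sub_le {r' r a b : ℝ} (hcons : ∀ s ∈ S, s < r → s ≤ r') (hr2 : 2 * r' < r)
    (ha : a ∈ S) (hb : r ≤ b) (hab : |a - b| ≤ r') : r ≤ a := by
  by_contra! h
  linarith [hcons a ha h, (abs_le.1 hab).1]

theorem IsUrysohn.abs_sub_le_trans (hU : IsUrysohn S U) {r' r a b c : ℝ} (hr'S : r' ∈ S)
    (hcons : ∀ s ∈ S, s < r → s ≤ r') (hr2 : 2 * r' < r) (ha : a ∈ S) (hb : b ∈ S) (hc : c ∈ S)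
    (hca : r ≤ c) (hac : |a - c| ≤ r') (hbc : |b - c| ≤ r') : |a - b| ≤ r' := by
  have hr' := hU.pos r' hr'S
  have e1 := le_of_abs_sub_le hcons hr2 ha hca hac
  have e2 := le_of_abs_sub_le hcons hr2 hb hca hbc
  obtain ⟨u, hu, h1, h2⟩ := hU.exists_abs_sub_le ha hb hc hr'S (by linarith) (by linarith) hac hbc
  exact h1.trans (hcons u hu (by linarith))

/-- A type over `G` that is close to the restriction of a type over `G'` extends to a close type
over `G'`. -/
theorem IsUrysohn.exists_close_extension (hU : IsUrysohn S U) {r' r : ℝ} (hr'S : r' ∈ S)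
    (hcons : ∀ s ∈ S, s < r → s ≤ r') (hr2 : 2 * r' < r) {G G' : Finset U} (hGG' : G ⊆ G')
    {f k : U → ℝ} (hf : IsKatetov S (G : Set U) f) (hk : IsKatetov S (G' : Set U) k)
    (hkr : ∀ x ∈ G', r ≤ k x) (hfk : ∀ x ∈ G, |f x - k x| ≤ r') :
    ∃ g, IsKatetov S (G' : Set U) g ∧ (∀ x ∈ G, g x = f x) ∧ (∀ x ∈ G', |g x - k x| ≤ r') ∧
      ∀ x ∈ G', r ≤ g x := by
  have hr' := hU.pos r' hr'S
  obtain ⟨y, -, hy⟩ := hU.hasExtension G' (Set.subset_univ _) k hk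
  have hyn : y ∉ G := (hy.mono hGG').notMem fun z hz => by linarith [hkr z (hGG' hz)]
  have hK := hf.update_of_abs_sub_le hyn hr'S hr' fun z hz => by
    rw [hy z (hGG' hz)]
    exact ⟨hfk z hz, by linarith [hkr z (hGG' hz), hU.pos _ (hf.1 z hz)]⟩
  obtain ⟨g, hg, hgW, -⟩ := hU.exists_isKatetov_extension hK
  have hgy : g y = r' := by
    rw [hgW y (Finset.mem_insert_self _ _), Function.update_self]
  have hclose : ∀ x ∈ G', |g x - k x| ≤ r' := fun x hx => by
    have e1 := hg.2 x trivial y trivial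
    have e2 := hy x hx
    rw [dist_comm x y, hgy, e2] at e1
    rw [abs_le]
    exact ⟨by linarith [e1.2], by linarith [e1.1]⟩
  refine ⟨g, hg.mono (Set.subset_univ _), fun x hx => ?_, hclose, fun x hx =>
    le_of_abs_sub_le hcons hr2 (hg.1 x trivial) (hkr x hx) (hclose x hx)⟩
  rw [hgW x (Finset.mem_insert_of_mem hx)]
  exact Function.update_of_ne (by rintro rfl; exact hyn hx) _ _

/-- If no point of type `q` works for `p` and `Γ`, then some type close to `q` is good for `Γᶜ` and
for all types below some extension of `q`. -/
theorem IsUrysohn.exists_forall_isGood (hU : IsUrysohn S U) {r' r : ℝ} (hr'S : r' ∈ S)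
    (hcons : ∀ s ∈ S, s < r → s ≤ r') (hr2 : 2 * r' < r)
    (hstar : ∀ a ∈ S, ∀ b ∈ S, ∀ s ∈ S, r ≤ a → a < b → b ≤ a + s → ∀ a' ∈ S, ∀ b' ∈ S,
      r ≤ a' → r ≤ b' → |a' - b'| ≤ r' → |a' - b'| ≤ s)
    (hmono : HasMono S U r') {Γ C : Set U} {F G : Finset U} {p q : U → ℝ}
    (hC : HasExtension S C) (hFG : F ⊆ G) (hG : (G : Set U) ⊆ C) (hq : IsKatetov S (G : Set U) q)
    (hqr : ∀ x ∈ G, r ≤ q x) (hno : ∀ C' ⊆ C, HasExtension S C' → (G : Set U) ⊆ C' → ∀ x ∈ C',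
      Realizes G q x → ∃ w ∈ C', Realizes F p w ∧ (∀ z ∈ G, r ≤ dist w z) ∧ dist w x = r' ∧ w ∉ Γ) :
    ∃ h, IsKatetov S (G : Set U) h ∧ (∀ x ∈ F, h x = p x) ∧ (∀ x ∈ G, |h x - q x| ≤ r') ∧
      ∃ q' G' C', IsBelow S r q G C q' G' C' ∧ ∀ q'' G'' C'', IsBelow S r q' G' C' q'' G'' C'' →
        IsGood S r' Γᶜ h G q'' G'' C'' := by
  have hr' := hU.pos r' hr'S
  obtain ⟨T₀, hT₀, hT₀inj, hT₀all⟩ := exists_finset_isKatetov hU.finite G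
  obtain ⟨T, hTdef⟩ : ∃ T : Finset (U → ℝ), ∀ h, h ∈ T ↔ h ∈ T₀ ∧ (∀ x ∈ F, h x = p x) ∧
    ∀ x ∈ G, |h x - q x| ≤ r' := ⟨T₀.filter _, fun h => Finset.mem_filter⟩
  by_contra! hcon
  obtain ⟨q₁, G₁, C₁, hb, hbad⟩ : ∃ q₁ G₁ C₁, IsBelow S r q G C q₁ G₁ C₁ ∧
      ∀ h ∈ T, ¬ IsGood S r' Γᶜ h G q₁ G₁ C₁ := by
    have : ∀ T' ⊆ T, ∃ q₁ G₁ C₁, IsBelow S r q G C q₁ G₁ C₁ ∧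
        ∀ h ∈ T', ¬ IsGood S r' Γᶜ h G q₁ G₁ C₁ := by
      intro T' hT'
      induction T' using Finset.induction_on with
      | empty => exact ⟨q, G, C, ⟨subset_rfl, hC, subset_rfl, hG, hq, fun _ _ => rfl, hqr⟩, by simp⟩
      | insert h T' _ ih =>
        obtain ⟨q₁, G₁, C₁, hb, hbad⟩ := ih ((Finset.subset_insert _ _).trans hT')
        obtain ⟨e1, e2, e3⟩ := (hTdef h).1 (hT' (Finset.mem_insert_self _ _))
        obtain ⟨q₂, G₂, C₂, hb₂, hbad₂⟩ := hcon h (hT₀ h e1) e2 e3 q₁ G₁ C₁ hb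
        refine ⟨q₂, G₂, C₂, hb₂.trans hb, fun k hk => ?_⟩
        rcases Finset.mem_insert.1 hk with rfl | hk
        · exact hbad₂
        · exact fun hg => hbad k hk (hg.of_isBelow hb₂)
    exact this T subset_rfl
  obtain ⟨x, hx, hxG⟩ := hb.hasExtension G₁ hb.mem q₁ hb.isKatetov
  have hxn : x ∉ G₁ := hxG.notMem fun z hz => by linarith [hb.le_rank z hz]
  have hsub : ((insert x G₁ : Finset U) : Set U) ⊆ C₁ := by
    rw [Finset.coe_insert]
    exact Set.insert_subset hx hb.mem
  obtain ⟨C₂, hC₂, hext₂, hG₂, hall⟩ := hU.exists_captured_all hmono Γ hb.hasExtension hsub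
  have hxC₂ := hG₂ (Finset.mem_insert_self x G₁)
  have hG₁C₂ : (G₁ : Set U) ⊆ C₂ := fun z hz => hG₂ (Finset.mem_insert_of_mem hz)
  have hclose : ∀ w, dist w x = r' → ∀ z ∈ G₁, |dist w z - q₁ z| ≤ r' := fun w hw z hz => by
    rw [← hxG z hz, ← hw]
    exact abs_dist_sub_le w x z
  have hclosed : ∀ w, dist w x = r' → w ∉ insert x G₁ := fun w hw h => by
    rcases Finset.mem_insert.1 h with rfl | h
    · rw [dist_self] at hw
      linarith
    · have e1 := (abs_le.1 (hclose w hw w h)).1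
      rw [dist_self] at e1
      linarith [hb.le_rank w h]
  have hfar : ∀ w, dist w x = r' → ∀ z ∈ G₁, r ≤ dist w z := fun w hw z hz =>
    le_of_abs_sub_le hcons hr2 (hU.dist_mem w z (by
      rintro rfl; exact hclosed w hw (Finset.mem_insert_of_mem hz))) (hb.le_rank z hz)
      (hclose w hw z hz)
  have hex : ∀ h ∈ T, ∃ w ∈ C₂, Realizes G h w ∧ dist w x = r' ∧
      Captured Γ C₂ (insert x G₁) fun z => dist w z := by
    intro h hh
    by_contra! hno'
    refine hbad h hh ⟨C₂, hC₂, hext₂, hG₁C₂, x, hxC₂, hxG, fun w hw hwG hwx => ?_⟩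
    refine (hall _ (hU.isKatetov_dist (by exact_mod_cast hclosed w hwx)) (fun z hz => ?_)
      ⟨x, Finset.mem_insert_self _ _, hwx⟩).resolve_left (hno' w hw hwG hwx) w hw fun _ _ => rfl
    rcases Finset.mem_insert.1 hz with rfl | hz
    · exact hwx.ge
    · linarith [hfar w hwx z hz]
  have : Nonempty U := ⟨x⟩
  choose! ω hωC hωG hωx hωΓ using hex
  have hGx : G ⊆ insert x G₁ := hb.le.trans (Finset.subset_insert _ _)
  obtain ⟨C₃, hC₃, hext₃, hG₃, hrem⟩ := hU.exists_removal (insert x G) G₁ hext₂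
    (by
      rw [Finset.coe_insert]
      exact Set.insert_subset hxC₂ ((Finset.coe_subset.2 hb.le).trans hG₁C₂)) hG₁C₂
    (A := {a | ∃ h ∈ T, a = fun z => dist (ω h) z}) (by
      rintro _ ⟨h, hh, rfl⟩
      refine hU.isKatetov_dist ?_
      rw [Finset.insert_union, Finset.union_eq_right.2 hb.le]
      exact_mod_cast hclosed _ (hωx h hh)) (by
      rintro _ ⟨h, hh, rfl⟩ _ ⟨k, hk, rfl⟩ v w hv hw z hz
      have hvx := hv x (Finset.mem_insert_self _ _)
      have hwx := hw x (Finset.mem_insert_self _ _)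
      simp only [hωx h hh] at hvx
      simp only [hωx k hk] at hwx
      have hvw : dist v w ≤ 2 * r' := by linarith [dist_triangle_right v w x]
      have f1 := hfar _ (hωx h hh) z hz
      have f2 := hfar _ (hωx k hk) z hz
      refine ⟨?_, by linarith⟩
      by_cases hhk : h = k
      · rw [hhk]
        linarith [dist_nonneg (x := v) (y := w)]
      suffices |dist (ω h) z - dist (ω k) z| ≤ dist v w by linarith [(abs_le.1 this).2]
      obtain ⟨y, hy, hyne⟩ : ∃ y ∈ G, h y ≠ k y := by
        by_contra! hcon'
        exact hhk (hT₀inj h ((hTdef h).1 hh).1 k ((hTdef k).1 hk).1 hcon')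
      have hvy := hv y (Finset.mem_insert_of_mem hy)
      have hwy := hw y (Finset.mem_insert_of_mem hy)
      simp only [hωG h hh y hy] at hvy
      simp only [hωG k hk y hy] at hwy
      have hhy : r ≤ h y := by rw [← hωG h hh y hy]; exact hfar _ (hωx h hh) y (hb.le hy)
      have hky : r ≤ k y := by rw [← hωG k hk y hy]; exact hfar _ (hωx k hk) y (hb.le hy)
      have hhS := (hT₀ h ((hTdef h).1 hh).1).1 y hy
      have hkS := (hT₀ k ((hTdef k).1 hk).1).1 y hy
      have hne : v ≠ w := by
        rintro rfl
        exact hyne (hvy.symm.trans hwy)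
      have hs := hU.dist_mem v w hne
      have d1 := dist_triangle v w y
      have d2 := dist_triangle_left w y v
      have hωS : ∀ l ∈ T, dist (ω l) z ∈ S := fun l hl => hU.dist_mem _ _ (by
        intro h
        exact hclosed _ (hωx l hl) (Finset.mem_insert_of_mem (h ▸ hz)))
      have hab := hU.abs_sub_le_trans hr'S hcons hr2 (hωS h hh) (hωS k hk) (hb.isKatetov.1 z hz)
        (hb.le_rank z hz) (hclose _ (hωx h hh) z hz) (hclose _ (hωx k hk) z hz)
      rcases lt_or_gt_of_ne hyne with hlt | hlt
      · exact hstar _ hhS _ hkS _ hs hhy hlt (by linarith) _ (hωS h hh) _ (hωS k hk) f1 f2 hab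
      · exact hstar _ hkS _ hhS _ hs hky hlt (by linarith) _ (hωS h hh) _ (hωS k hk) f1 f2 hab)
  have hxC₃ := hG₃ (Finset.mem_insert_self x G)
  obtain ⟨w, hw, hwF, -, hwx, hwΓ⟩ := hno C₃ (hC₃.trans (hC₂.trans hb.subset)) hext₃
    (fun z hz => hG₃ (Finset.mem_insert_of_mem hz)) x hxC₃ fun z hz => by
      rw [hxG z (hb.le hz), hb.eq z hz]
  obtain ⟨h, hh, hhw⟩ := hT₀all _ (hU.isKatetov_dist (W := (G : Set U)) (y := w)
    fun h => hclosed w hwx (hGx h))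
  have hhT : h ∈ T := by
    refine (hTdef h).2 ⟨hh, fun z hz => ?_, fun z hz => ?_⟩
    · rw [hhw z (hFG hz), hwF z hz]
    · rw [hhw z hz, ← hb.eq z hz]
      exact hclose w hwx z (hb.le hz)
  have hwE := hrem _ ⟨h, hhT, rfl⟩ w hw fun z hz => by
    rcases Finset.mem_insert.1 hz with rfl | hz
    · exact hwx.trans (hωx h hhT).symm
    · exact (hhw z hz).symm.trans (hωG h hhT z hz).symm
  refine hwΓ (hωΓ h hhT w (hC₃ hw) fun z hz => ?_)
  rcases Finset.mem_insert.1 hz with rfl | hz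
  · exact hwx.trans (hωx h hhT).symm
  · exact hwE z hz

/-- Orbits of rank `r` inherit monochromaticity from the preceding rank `r' < r / 2`. -/
theorem IsUrysohn.hasMono_of_two_mul_lt (hU : IsUrysohn S U) {r' r : ℝ} (hr'S : r' ∈ S)
    (hrS : r ∈ S) (hcons : ∀ s ∈ S, s < r → s ≤ r') (hr2 : 2 * r' < r)
    (hstar : ∀ a ∈ S, ∀ b ∈ S, ∀ s ∈ S, r ≤ a → a < b → b ≤ a + s → ∀ a' ∈ S, ∀ b' ∈ S,
      r ≤ a' → r ≤ b' → |a' - b'| ≤ r' → |a' - b'| ≤ s)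
    (hmono : HasMono S U r') : HasMono S U r := by
  intro Γ C F p hC hF hp hpr hpx
  have hr' := hU.pos r' hr'S
  have hr : r' < r := by linarith
  by_cases hcen : HasCenter S r' r Γ F p C
  · obtain ⟨C', h1, h2, h3, h4⟩ := hU.exists_captured_of_extension hr'S hr hcons hC hF subset_rfl hp
      hpr (fun _ _ => rfl) hpx (hcen.hasApproach hrS)
    exact ⟨C', h1, h2, h3, Or.inl h4⟩
  unfold HasCenter at hcen
  push Not at hcen
  obtain ⟨C₁, hC₁, hext₁, G, hFG, hG, q, hq, hqr, hno⟩ := hcen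
  obtain ⟨h, hh, hhp, hhq, q', G', C', hb, hgood⟩ := hU.exists_forall_isGood hr'S hcons hr2 hstar
    hmono hext₁ hFG hG hq hqr hno
  obtain ⟨p', hp', hp'h, hp'q, hp'r⟩ := hU.exists_close_extension hr'S hcons hr2 hb.le hh
    hb.isKatetov hb.le_rank fun x hx => by rw [hb.eq x hx]; exact hhq x hx
  obtain ⟨C₂, h1, h2, h3, h4⟩ := hU.exists_captured_of_extension (Γ := Γᶜ) hr'S hr hcons
    hb.hasExtension hb.mem (hFG.trans hb.le) hp' hp'r
    (fun x hx => by rw [hp'h x (hFG hx), hhp x hx]) hpx (by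
    rintro C'' hC'' hext'' G'' hG'G'' hG'' g hg ⟨h₀, hh₀⟩
    obtain ⟨q'', hq'', hq''q', hq''h₀, hq''r⟩ := hU.exists_close_extension hr'S hcons hr2 hG'G''
      hb.isKatetov hh₀.isKatetov hh₀.le fun x hx => by
        rw [hh₀.eq x hx, abs_sub_comm]
        exact hp'q x hx
    obtain ⟨C₃, e1, e2, e3, x, hx, hxG, hxΓ⟩ := hgood q'' G'' C''
      ⟨hC'', hext'', hG'G'', hG'', hq'', hq''q', hq''r⟩
    have hg0 : ∀ z ∈ G'', |g z - h₀ z| ≤ r' := fun z hz => by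
      rw [abs_sub_comm]
      exact hh₀.abs_sub_le z hz
    have hgr : ∀ z ∈ G'', r ≤ g z := fun z hz =>
      le_of_abs_sub_le hcons hr2 (hg.1 z hz) (hh₀.le z hz) (hg0 z hz)
    have hgq : ∀ z ∈ G'', |g z - q'' z| ≤ r' := fun z hz =>
      hU.abs_sub_le_trans hr'S hcons hr2 (hg.1 z hz) (hq''.1 z hz) (hh₀.isKatetov.1 z hz)
        (hh₀.le z hz) (hg0 z hz) (hq''h₀ z hz)
    refine ⟨C₃, e1, e2, e3, x, hx, fun z hz => ?_, fun z hz => ?_, fun k hk z hz => ?_,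
      fun k hk w hw hwG hwx => hxΓ w hw (fun z hz => ?_) hwx⟩
    · rw [hxG z hz]
      exact hq''r z hz
    · rw [hxG z hz]
      exact hgq z hz
    · rw [hxG z hz]
      refine hU.abs_sub_le_trans hr'S hcons hr2 (hk.isKatetov.1 z hz) (hq''.1 z hz) (hg.1 z hz)
        (hgr z hz) (hk.abs_sub_le z hz) ?_
      rw [abs_sub_comm]
      exact hgq z hz
    · rw [hwG z (hG'G'' (hb.le hz)), hk.eq z (hb.le hz), hp'h z hz])
  exact ⟨C₂, h1.trans (hb.subset.trans hC₁), h2, h3, Or.inr h4⟩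

theorem eq_of_four_mem (hfin : S.Finite) (hcard : S.ncard ≤ 4) {a b c d : ℝ} (ha : a ∈ S)
    (hb : b ∈ S) (hc : c ∈ S) (hd : d ∈ S) (hab : a < b) (hbc : b < c) (hcd : c < d) {x : ℝ}
    (hx : x ∈ S) : x = a ∨ x = b ∨ x = c ∨ x = d := by
  have hsub : (({a, b, c, d} : Finset ℝ) : Set ℝ) ⊆ S := by
    intro y hy
    simp only [Finset.coe_insert, Finset.coe_singleton, Set.mem_insert_iff,
      Set.mem_singleton_iff] at hy
    rcases hy with rfl | rfl | rfl | rfl <;> assumption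
  have h4 : ({a, b, c, d} : Finset ℝ).card = 4 := by
    rw [Finset.card_insert_of_notMem, Finset.card_insert_of_notMem, Finset.card_pair hcd.ne]
    · simp only [Finset.mem_insert, Finset.mem_singleton, not_or]
      exact ⟨hbc.ne, (hbc.trans hcd).ne⟩
    · simp only [Finset.mem_insert, Finset.mem_singleton, not_or]
      exact ⟨hab.ne, (hab.trans hbc).ne, (hab.trans (hbc.trans hcd)).ne⟩
  have heq := Set.eq_of_subset_of_ncard_le hsub (by rwa [Set.ncard_coe_finset, h4]) hfin
  rw [← heq] at hx
  simpa using hx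

/-- The passage from a rank to the next one, for distance sets with at most four elements. -/
theorem IsUrysohn.hasMono_succ (hU : IsUrysohn S U) (hcard : S.ncard ≤ 4) {r' r M : ℝ}
    (hr'S : r' ∈ S) (hrS : r ∈ S) (hr : r' < r) (hcons : ∀ s ∈ S, s < r → s ≤ r') (hMS : M ∈ S)
    (hM : 2 * r' < M) (hmono : HasMono S U r') : HasMono S U r := by
  have hr'0 := hU.pos r' hr'S
  rcases le_or_gt r (2 * r') with h2 | h2
  · obtain ⟨R, hRS, hR2, hRmax⟩ := exists_mem_max_le hU.finite hrS h2
    have hrR := hRmax r hrS h2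
    refine hU.hasMono_of_le_two_mul hr'S hrS hr hcons hRS hrR hR2 hRmax ?_ hmono
    intro a ha b hb s hs hra hab hbs
    rcases le_or_gt r' s with hsr | hsr
    · linarith
    have h4 {x : ℝ} := eq_of_four_mem (x := x) hU.finite hcard hs hr'S hrS hMS hsr hr
      (h2.trans_lt hM)
    have hRr : R = r := by
      rcases h4 hRS with h | h | h | h <;> linarith
    have har : a = r := by
      rcases h4 ha with h | h | h | h
      · linarith
      · linarith
      · exact h
      · rcases h4 hb with h' | h' | h' | h' <;> linarith
    have hbM : b = M := by
      rcases h4 hb with h | h | h | h <;> first | exact h | linarith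
    subst hRr har hbM
    by_contra! hlt
    have hs0 := hU.pos s hs
    obtain ⟨u, hu, h1, h3, h5, h6⟩ := hU.fourValues s hs b hb r' hr'S r' hr'S
      ⟨a, ha, by rw [abs_le]; constructor <;> linarith, by linarith, by simp; linarith,
        by linarith⟩
    have := hcons u hu (by linarith)
    have := le_abs_self (b - r')
    linarith
  · refine hU.hasMono_of_two_mul_lt hr'S hrS hcons h2 ?_ hmono
    intro a ha b hb s hs hra hab hbs a' ha' b' hb' hra' hrb' hab'
    rcases le_or_gt r' s with hsr | hsr
    · exact hab'.trans hsr
    have h4 {x : ℝ} := eq_of_four_mem (x := x) hU.finite hcard hs hr'S ha hb hsr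
      (hr.trans_le hra) hab
    have hs0 := hU.pos s hs
    rw [abs_le]
    rcases h4 ha' with h | h | h | h <;> rcases h4 hb' with h' | h' | h' | h' <;> subst h h' <;>
      constructor <;> linarith

/-- Some rank `r` with `max S ≤ 2 * r` has monochromatic orbits. -/
theorem IsUrysohn.exists_hasMono (hU : IsUrysohn S U) (hcard : S.ncard ≤ 4) :
    ∃ r ∈ S, (∀ s ∈ S, s ≤ 2 * r) ∧ HasMono S U r := by
  obtain ⟨M, hMS, hM⟩ := Set.exists_max_image S id hU.finite hU.nonempty
  by_contra! hno
  have key : ∀ r ∈ S, HasMono S U r := by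
    by_contra! hex
    obtain ⟨r, ⟨hrS, hr⟩, hmin⟩ := Set.exists_min_image {r ∈ S | ¬ HasMono S U r} id
      (hU.finite.subset (Set.sep_subset _ _)) hex
    by_cases hlow : ∀ s ∈ S, r ≤ s
    · exact hr (hU.hasMono_min hlow)
    push Not at hlow
    obtain ⟨r', ⟨hr'S, hr'⟩, hmax⟩ := Set.exists_max_image {s ∈ S | s < r} id
      (hU.finite.subset (Set.sep_subset _ _)) hlow
    have hmono : HasMono S U r' := by
      by_contra h
      exact absurd (hmin r' ⟨hr'S, h⟩) (not_le.2 hr')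
    have hM' : 2 * r' < M := by
      by_contra! h
      exact hno r' hr'S (fun s hs => (hM s hs).trans h) hmono
    exact hr (hU.hasMono_succ hcard hr'S hrS hr' (fun s hs h => hmax s ⟨hs, h⟩) hMS hM' hmono)
  have hM0 := hU.pos M hMS
  refine hno M hMS (fun s hs => (hM s hs).trans ?_) (key M hMS)
  show M ≤ 2 * M
  linarith

theorem IsUrysohn.exists_isometry (hU : IsUrysohn S U) (hcard : S.ncard ≤ 4) (Γ : Set U) :
    ∃ φ : U → U, Isometry φ ∧ ((∀ v, φ v ∈ Γ) ∨ ∀ v, φ v ∈ Γᶜ) := by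
  obtain ⟨r, hrS, hr, hmono⟩ := hU.exists_hasMono hcard
  have hr0 := hU.pos r hrS
  obtain ⟨z, -, -⟩ := hU.hasExtension ∅ (by simp) (fun _ => r) ⟨by simp, by simp⟩
  have hD : IsKatetov S Set.univ (fun _ : U => r) := by
    refine ⟨fun _ _ => hrS, fun x _ y _ => ⟨by linarith [dist_nonneg (x := x) (y := y)], ?_⟩⟩
    rw [← two_mul]
    rcases eq_or_ne x y with rfl | hxy
    · rw [dist_self]; positivity
    · exact hr _ (hU.dist_mem x y hxy)
  obtain ⟨C, -, hC, hzC, hcap⟩ := hmono Γ Set.univ {z} (fun _ => r) hU.hasExtension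
    (Set.subset_univ _) (hD.mono (Set.subset_univ _)) (by simp) (by simp)
  obtain ⟨φ, hφ, -, hφC, hφz⟩ := hU.exists_embedding hC (B := ∅) (by simp) (hzC (by simp))
    (Finset.notMem_empty z) hD (by simp)
  have hreal : ∀ v, Realizes {z} (fun _ => r) (φ v) := fun v x hx => by
    rw [Finset.mem_singleton.1 hx, dist_comm, hφz]
  exact ⟨φ, hφ, hcap.imp (fun h v => h _ (hφC v) (hreal v)) fun h v => h _ (hφC v) (hreal v)⟩

theorem IsUrysohn.indivisible (hU : IsUrysohn S U) (hcard : S.ncard ≤ 4) : Indivisible U := by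
  intro k hk
  induction k, hk using Nat.le_induction with
  | base => exact fun χ => ⟨0, id, isometry_id, fun _ => Subsingleton.elim _ _⟩
  | succ k hk ih =>
    intro χ
    obtain ⟨φ, hφ, h | h⟩ := hU.exists_isometry hcard {v | χ v = Fin.last k}
    · exact ⟨_, φ, hφ, h⟩
    · obtain ⟨i, e, he, hi⟩ := ih fun v => (χ (φ v)).castPred (h v)
      exact ⟨i.castSucc, φ ∘ e, hφ.comp he, fun v => by
        rw [← hi v, Fin.castSucc_castPred, Function.comp_apply]⟩

/-- The one-point extension of `F` by a point with distances `f` to `F`. -/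
noncomputable abbrev optionMetricSpace (hpos : ∀ s ∈ S, 0 < s) (F : Finset U) (f : U → ℝ)
    (hf : IsKatetov S (F : Set U) f) : MetricSpace (Option F) where
  dist
    | none, none => 0
    | none, some x => f x
    | some x, none => f x
    | some x, some y => dist x y
  dist_self x := by cases x <;> simp
  dist_comm x y := by cases x <;> cases y <;> simp [dist_comm]
  dist_triangle
    | none, none, none => by simp
    | none, none, some x => by simp
    | none, some x, none => by have := hpos _ (hf.1 x x.2); simp; linarith
    | none, some x, some y => by
      have := (hf.2 y y.2 x x.2).1
      rw [dist_comm] at this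
      show f y ≤ f x + dist (x : U) y
      linarith
    | some x, none, none => by simp
    | some x, none, some y => (hf.2 x x.2 y y.2).2
    | some x, some y, none => (hf.2 x x.2 y y.2).1
    | some x, some y, some z => dist_triangle x y z
  eq_of_dist_eq_zero {x y} h := by
    match x, y, h with
    | none, none, _ => rfl
    | none, some x, h => exact absurd h (hpos _ (hf.1 x x.2)).ne'
    | some x, none, h => exact absurd h (hpos _ (hf.1 x x.2)).ne'
    | some x, some y, h => exact congrArg some (eq_of_dist_eq_zero h)

theorem hasExtension_univ {X : Type} [MetricSpace X] (hpos : ∀ s ∈ S, 0 < s)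
    (hd : ∀ x y : X, x ≠ y → dist x y ∈ S) (hultra : IsUltrahomogeneous X)
    (huniv : ∀ (Y : Type) [MetricSpace Y], Countable Y →
      (∀ a b : Y, a ≠ b → dist a b ∈ S) → ∃ f : Y → X, Isometry f) :
    HasExtension S (Set.univ : Set X) := by
  intro F _ f hf
  let _ : MetricSpace (Option F) := optionMetricSpace hpos F f hf
  obtain ⟨g, hg⟩ := huniv (Option F) inferInstance (by
    rintro (_ | x) (_ | y) h
    · exact absurd rfl h
    · exact hf.1 y y.2
    · exact hf.1 x x.2
    · exact hd x y fun hxy => h (congrArg some (Subtype.ext hxy)))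
  have hgF : Isometry fun x : F => g (some x) :=
    Isometry.of_dist_eq fun x y => hg.dist_eq (some x) (some y)
  have hrange : (Set.range fun x : F => g (some x)).Finite := Set.finite_range _
  obtain ⟨ψ, hψ⟩ := hultra _ hrange (fun y => (hgF.isometryEquivOnRange.symm y : X))
    (isometry_subtype_coe.comp hgF.isometryEquivOnRange.symm.isometry)
  refine ⟨ψ (g none), trivial, fun x hx => ?_⟩
  have hx' : ψ (g (some ⟨x, hx⟩)) = x := by
    have := hψ (hgF.isometryEquivOnRange ⟨x, hx⟩)
    rw [IsometryEquiv.symm_apply_apply] at this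
    exact this
  calc dist (ψ (g none)) x = dist (ψ (g none)) (ψ (g (some ⟨x, hx⟩))) := by rw [hx']
    _ = dist (none : Option F) (some ⟨x, hx⟩) := by rw [ψ.isometry.dist_eq, hg.dist_eq]
    _ = f x := rfl

end UrysohnIndivisible

/-- For `S` finite of size at most `4` satisfying the 4-values condition and
not `∼`-equivalent to `{1,2,3,4}`, the space `U_S` is indivisible. -/
theorem stmt17 (S : Set ℝ) (hfin : S.Finite) (hpos : ∀ s ∈ S, 0 < s)
    (hcard : S.ncard ≤ 4) (h4v : FourValues S)
    (hnsim : ¬ SimDist S {1, 2, 3, 4})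
    (US : Type) [MetricSpace US] (hc : Countable US)
    (hd : ∀ x y : US, x ≠ y → dist x y ∈ S)
    (hultra : IsUltrahomogeneous US)
    (huniv : ∀ (Y : Type) [MetricSpace Y], Countable Y →
      (∀ a b : Y, a ≠ b → dist a b ∈ S) → ∃ f : Y → US, Isometry f) :
    Indivisible US := by
  rcases S.eq_empty_or_nonempty with rfl | hne
  · intro k hk χ
    obtain ⟨f, -⟩ := huniv Unit inferInstance fun a b h => absurd (Subsingleton.elim a b) h
    refine ⟨χ (f ()), id, isometry_id, fun z => ?_⟩
    by_contra hz
    exact hd z (f ()) fun h => hz (congrArg χ h)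
  · exact IsUrysohn.indivisible ⟨hfin, hne, hpos, h4v, hc, hd,
      hasExtension_univ hpos hd hultra huniv⟩ hcard
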